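/- arXiv:1101.2618 — 10 statements merged into one kernel-verified Lean document; each statement's English description precedes it below -/
import Mathlib

section
/- Let X be a metric space, G : X → ℝ an upper semicontinuous function and g : X → ℝ a lower semicontinuous function such that G(x) < g(x) for every x ∈ X. Then there exists a continuous function φ : X → ℝ such that G(x) < φ(x) < g(x) for every x ∈ X. -/
/-- Insertion of a continuous function between an upper
semicontinuous function and a strictly larger lower semicontinuous function on
a metric space. -/
theorem continuous_insertion_between_semicontinuous
    {X : Type*} [MetricSpace X] (G g : X → ℝ)
    (hG : UpperSemicontinuous G) (hg : LowerSemicontinuous g)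
    (hlt : ∀ x, G x < g x) :
    ∃ φ : X → ℝ, Continuous φ ∧ ∀ x, G x < φ x ∧ φ x < g x := by
  obtain ⟨φ, hφ⟩ := exists_continuous_forall_mem_convex_of_local_const
    (t := fun x => Set.Ioo (G x) (g x)) (fun x => convex_Ioo _ _) fun x => by
      obtain ⟨c, hGc, hcg⟩ := exists_between (hlt x)
      exact ⟨c, (hG x c hGc).and (hg x c hcg)⟩
  exact ⟨φ, φ.continuous, hφ⟩
end

section
/- Let X be a nonempty set and G : X → X → [0,∞] a symmetric function. Then the sequence (n·τ_n(X)) is superadditive, i.e. (n+m)·τ_{n+m}(X) ≥ n·τ_n(X) + m·τ_m(X) for all n, m ≥ 1, and consequently τ_n(X) converges in [0,∞], as n → ∞, to sup_{n ≥ 1} τ_n(X). -/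
/-- The `n`-th Tchebycheff quantity
`τ_n(X) = n⁻¹ · sup { inf_{p ∈ X} Σ_i G(p,p_i) : (p_1,…,p_n) ∈ Xⁿ }`,
with arithmetic in `[0,∞]`. -/
noncomputable def tauTcheb {X : Type*} (G : X → X → ENNReal) (n : ℕ) : ENNReal :=
  ((n : ENNReal))⁻¹ * ⨆ p : Fin n → X, ⨅ q : X, ∑ i : Fin n, G q (p i)

/-- **Fekete's lemma** for superadditive sequences with values in `[0, ∞]`. -/
theorem ENNReal.tendsto_inv_mul_iSup_of_superadditive {u : ℕ → ENNReal}
    (hu : ∀ n m, u n + u m ≤ u (n + m)) :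
    Filter.Tendsto (fun n : ℕ => (n : ENNReal)⁻¹ * u n) Filter.atTop
      (nhds (⨆ (n : ℕ) (_ : 1 ≤ n), (n : ENNReal)⁻¹ * u n)) := by
  have hmul (k m : ℕ) : (k : ENNReal) * u m ≤ u (k * m) := by
    induction k with
    | zero => simp
    | succ k ih =>
      calc ((k + 1 : ℕ) : ENNReal) * u m = k * u m + u m := by push_cast; ring
        _ ≤ u (k * m) + u m := by gcongr
        _ ≤ u ((k + 1) * m) := by rw [add_one_mul]; exact hu _ _
  have hdiv (n m : ℕ) : ((n / m : ℕ) : ENNReal) * u m ≤ u n :=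
    calc ((n / m : ℕ) : ENNReal) * u m ≤ u (n / m * m) := hmul _ _
      _ ≤ u (n / m * m) + u (n % m) := le_self_add
      _ ≤ u n := by simpa only [Nat.div_add_mod'] using hu (n / m * m) (n % m)
  have hlim (m : ℕ) (hm : 1 ≤ m) :
      Filter.Tendsto (fun n : ℕ => (n : ENNReal)⁻¹ * (((n / m : ℕ) : ENNReal) * u m))
        Filter.atTop (nhds ((m : ENNReal)⁻¹ * u m)) := by
    have hfloor := ENNReal.tendsto_ofReal
      ((tendsto_nat_floor_mul_div_atTop (R := ℝ) (a := (m : ℝ)⁻¹) (by positivity)).comp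
        tendsto_natCast_atTop_atTop)
    rw [ENNReal.ofReal_inv_of_pos (by positivity), ENNReal.ofReal_natCast] at hfloor
    refine (ENNReal.Tendsto.mul_const hfloor (.inl (by simp))).congr' ?_
    filter_upwards [Filter.eventually_gt_atTop 0] with n hn
    have hn' : (0 : ℝ) < n := by exact_mod_cast hn
    rw [Function.comp_apply, ENNReal.ofReal_div_of_pos hn', inv_mul_eq_div,
      Nat.floor_div_natCast, Nat.floor_natCast, ENNReal.ofReal_natCast, ENNReal.ofReal_natCast,
      div_eq_mul_inv, mul_comm _ (n : ENNReal)⁻¹, mul_assoc]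
  refine tendsto_order.2 ⟨fun a ha => ?_, fun a ha => ?_⟩
  · simp only [lt_iSup_iff] at ha
    obtain ⟨m, hm, ham⟩ := ha
    filter_upwards [(hlim m hm).eventually_const_lt ham] with n hn
    exact hn.trans_le (by gcongr; exact hdiv n m)
  · filter_upwards [Filter.eventually_ge_atTop 1] with n hn
    exact (le_iSup₂ (f := fun (n : ℕ) (_ : 1 ≤ n) => (n : ENNReal)⁻¹ * u n) n hn).trans_lt ha

theorem iSup_iInf_sum_superadditive {X : Type*} [Nonempty X] (G : X → X → ENNReal) (n m : ℕ) :
    (⨆ p : Fin n → X, ⨅ q : X, ∑ i, G q (p i)) + (⨆ p : Fin m → X, ⨅ q : X, ∑ i, G q (p i)) ≤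
      ⨆ p : Fin (n + m) → X, ⨅ q : X, ∑ i, G q (p i) := by
  refine ENNReal.iSup_add_iSup_le fun p p' => le_iSup_of_le (Fin.append p p') ?_
  refine le_iInf fun q => ?_
  simp only [Fin.sum_univ_add, Fin.append_left, Fin.append_right]
  exact add_le_add (iInf_le _ q) (iInf_le _ q)

theorem natCast_mul_tauTcheb {X : Type*} (G : X → X → ENNReal) {n : ℕ} (hn : 1 ≤ n) :
    (n : ENNReal) * tauTcheb G n = ⨆ p : Fin n → X, ⨅ q : X, ∑ i, G q (p i) :=
  ENNReal.mul_inv_cancel_left (by simpa using Nat.ne_of_gt hn) (ENNReal.natCast_ne_top n)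

/-- For a symmetric kernel on a nonempty set, the sequence
`n · τ_n(X)` is superadditive, and consequently `τ_n(X)` converges in `[0,∞]`
to `sup_{n ≥ 1} τ_n(X)`. -/
theorem tauTcheb_superadditive_and_tendsto_sup
    {X : Type*} [Nonempty X] (G : X → X → ENNReal)
    (hsymm : ∀ x y, G x y = G y x) :
    (∀ n m : ℕ, 1 ≤ n → 1 ≤ m →
      (n : ENNReal) * tauTcheb G n + (m : ENNReal) * tauTcheb G m ≤
        ((n + m : ℕ) : ENNReal) * tauTcheb G (n + m)) ∧
    Filter.Tendsto (fun n => tauTcheb G n) Filter.atTop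
      (nhds (⨆ (n : ℕ) (_ : 1 ≤ n), tauTcheb G n)) := by
  refine ⟨fun n m hn hm => ?_,
    ENNReal.tendsto_inv_mul_iSup_of_superadditive (iSup_iInf_sum_superadditive G)⟩
  rw [natCast_mul_tauTcheb G hn, natCast_mul_tauTcheb G hm,
    natCast_mul_tauTcheb G (hn.trans (Nat.le_add_right n m))]
  exact iSup_iInf_sum_superadditive G n m
end

section
/- Let X be a nonempty set and G : X → X → [0,∞] a symmetric function. Then the Tchebycheff constant dominates the transfinite diameter: τ(X) ≥ ρ(X), i.e. sup_{n ≥ 1} τ_n(X) ≥ sup_{n ≥ 2} ρ_n(X). -/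
/-- The `n`-th transfinite diameter quantity
`ρ_n(X) = (n(n−1)/2)⁻¹ · inf { Σ_{i<j} G(p_i,p_j) : p ∈ Xⁿ }`. -/
noncomputable def rhoDiam {X : Type*} (G : X → X → ENNReal) (n : ℕ) : ENNReal :=
  ((n.choose 2 : ℕ) : ENNReal)⁻¹ *
    ⨅ p : Fin n → X, ∑ i : Fin n, ∑ j : Fin n, if i < j then G (p i) (p j) else 0

theorem exists_sum_le_of_tauTcheb_lt {X : Type*} [Nonempty X] (G : X → X → ENNReal) {t : ENNReal}
    {n : ℕ} (ht : n ≠ 0 → tauTcheb G n < t) (p : Fin n → X) :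
    ∃ q, ∑ i, G q (p i) ≤ n * t := by
  rcases eq_or_ne n 0 with rfl | hn
  · exact ⟨Classical.arbitrary X, by simp⟩
  have hn0 : (n : ENNReal) ≠ 0 := by exact_mod_cast hn
  have hlt : (⨆ p : Fin n → X, ⨅ q : X, ∑ i, G q (p i)) < n * t := by
    have h := ht hn
    rwa [tauTcheb, mul_comm, ← div_eq_mul_inv,
      ENNReal.div_lt_iff (Or.inl hn0) (Or.inl (ENNReal.natCast_ne_top n)), mul_comm] at h
  obtain ⟨q, hq⟩ := iInf_lt_iff.1 ((le_iSup (fun p : Fin n → X => ⨅ q : X, ∑ i, G q (p i)) p).trans_lt hlt)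
  exact ⟨q, hq.le⟩

/-- If every finite configuration of points admits a point of small potential, then choosing points
greedily produces configurations of small energy. -/
theorem exists_energy_le {X : Type*} (G : X → X → ENNReal) {t : ENNReal}
    (h : ∀ (n : ℕ) (p : Fin n → X), ∃ q, ∑ i, G q (p i) ≤ n * t) (n : ℕ) :
    ∃ p : Fin n → X, (∑ i, ∑ j, if i < j then G (p i) (p j) else 0) ≤ (n.choose 2 : ℕ) * t := by
  induction n with
  | zero => exact ⟨Fin.elim0, by simp⟩
  | succ n ih =>
    obtain ⟨p, hp⟩ := ih
    obtain ⟨q, hq⟩ := h n p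
    refine ⟨Fin.cons q p, ?_⟩
    have hc : (n + 1).choose 2 = n + n.choose 2 := by simp [Nat.choose_succ_succ' n 1]
    rw [hc, Nat.cast_add, add_mul]
    simpa [Fin.sum_univ_succ] using add_le_add hq hp

/-- The Tchebycheff constant dominates the transfinite diameter:
`τ(X) = sup_{n ≥ 1} τ_n(X) ≥ sup_{n ≥ 2} ρ_n(X) = ρ(X)`. -/
theorem rho_le_tau {X : Type*} [Nonempty X] (G : X → X → ENNReal)
    (hsymm : ∀ x y, G x y = G y x) :
    (⨆ (n : ℕ) (_ : 2 ≤ n), rhoDiam G n) ≤ ⨆ (n : ℕ) (_ : 1 ≤ n), tauTcheb G n := by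
  refine le_of_forall_gt_imp_ge_of_dense fun t ht => iSup₂_le fun n hn => ?_
  have hτ (k : ℕ) (hk : k ≠ 0) : tauTcheb G k < t :=
    (le_iSup₂ (f := fun n (_ : 1 ≤ n) => tauTcheb G n) k (Nat.one_le_iff_ne_zero.2 hk)).trans_lt ht
  obtain ⟨p, hp⟩ := exists_energy_le G (fun k => exists_sum_le_of_tauTcheb_lt G (hτ k)) n
  rw [rhoDiam, mul_comm, ← div_eq_mul_inv]
  refine ENNReal.div_le_of_le_mul' ?_
  exact (iInf_le _ p).trans hp
end

section
/- Let X be a nonempty compact metric space and G : X → X → [0,∞] a symmetric function that is continuous as a map X × X → [0,∞]. Then the transfinite diameter dominates the minimal energy: ρ(X) ≥ ε(X), where ε(X) is the infimum over all Borel probability measures μ on X of the energy ∫∫ G(x,y) dμ(x) dμ(y). -/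
open MeasureTheory

open Filter Topology
open scoped ENNReal NNReal

/-- The empirical probability measure of a nonempty finite family of points. -/
noncomputable def empiricalMeasure {X : Type*} [MeasurableSpace X] {n : ℕ} [NeZero n]
    (p : Fin n → X) : ProbabilityMeasure X :=
  ⟨(n : ℝ≥0∞)⁻¹ • ∑ i, Measure.dirac (p i), ⟨by
    simp [ENNReal.inv_mul_cancel, NeZero.ne n]⟩⟩

theorem lintegral_empiricalMeasure {X : Type*} [MeasurableSpace X] {n : ℕ} [NeZero n]
    (p : Fin n → X) {f : X → ℝ≥0∞} (hf : Measurable f) :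
    ∫⁻ x, f x ∂(empiricalMeasure p : Measure X) = (n : ℝ≥0∞)⁻¹ * ∑ i, f (p i) := by
  simp [empiricalMeasure, lintegral_dirac' _ hf]

theorem lintegral_prod_empiricalMeasure {X : Type*} [MeasurableSpace X] {n : ℕ} [NeZero n]
    (p : Fin n → X) {f : X × X → ℝ≥0∞} (hf : Measurable f) :
    ∫⁻ z, f z ∂((empiricalMeasure p).prod (empiricalMeasure p) : Measure (X × X)) =
      (n : ℝ≥0∞)⁻¹ * ((n : ℝ≥0∞)⁻¹ * ∑ i, ∑ j, f (p i, p j)) := by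
  have h (x : X) : ∫⁻ y, f (x, y) ∂(empiricalMeasure p : Measure X) =
      (n : ℝ≥0∞)⁻¹ * ∑ j, f (x, p j) :=
    lintegral_empiricalMeasure p (hf.comp measurable_prodMk_left)
  rw [ProbabilityMeasure.toMeasure_prod, lintegral_prod _ hf.aemeasurable]
  simp_rw [h]
  rw [lintegral_empiricalMeasure p (by fun_prop), ← Finset.mul_sum]

theorem sum_sum_eq_sum_diag_add_two_mul {n : ℕ} (H : Fin n → Fin n → ℝ≥0∞)
    (hH : ∀ i j, H i j = H j i) :
    ∑ i, ∑ j, H i j = ∑ i, H i i + 2 * ∑ i, ∑ j, if i < j then H i j else 0 := by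
  have h (i j : Fin n) : H i j = (if i = j then H i j else 0) +
      ((if i < j then H i j else 0) + if j < i then H j i else 0) := by
    rcases lt_trichotomy i j with h | h | h
    · simp [h, h.ne, h.not_gt]
    · simp [h]
    · simp [h, h.ne', h.not_gt, hH i j]
  calc ∑ i, ∑ j, H i j = _ := Finset.sum_congr rfl fun i _ ↦ Finset.sum_congr rfl fun j _ ↦ h i j
    _ = _ := by
      simp only [Finset.sum_add_distrib]
      rw [two_mul, Finset.sum_comm (f := fun i j ↦ if j < i then H j i else 0)]
      simp

theorem exists_sum_eq_choose_mul_rhoDiam {X : Type*} [TopologicalSpace X] [CompactSpace X]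
    [Nonempty X] (G : X → X → ℝ≥0∞) (hcont : Continuous fun p : X × X => G p.1 p.2) {n : ℕ}
    (hn : 2 ≤ n) :
    ∃ p : Fin n → X, (∑ i : Fin n, ∑ j : Fin n, if i < j then G (p i) (p j) else 0) =
      (n.choose 2 : ℕ) * rhoDiam G n := by
  have hc : Continuous fun p : Fin n → X ↦
      ∑ i : Fin n, ∑ j : Fin n, if i < j then G (p i) (p j) else 0 := by
    refine continuous_finsetSum _ fun i _ ↦ continuous_finsetSum _ fun j _ ↦ ?_
    split_ifs
    · exact hcont.comp (by fun_prop : Continuous fun p : Fin n → X ↦ (p i, p j))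
    · exact continuous_const
  obtain ⟨p, -, hp⟩ := isCompact_univ.exists_isMinOn Set.univ_nonempty hc.continuousOn
  refine ⟨p, ?_⟩
  rw [rhoDiam, ← mul_assoc, ENNReal.mul_inv_cancel
    (by exact_mod_cast (Nat.choose_pos hn).ne') (ENNReal.natCast_ne_top _), one_mul]
  exact le_antisymm (le_iInf fun q ↦ hp (Set.mem_univ q)) (iInf_le _ p)

/-- Truncating the kernel at height `K`, the energy of the empirical measure of an `n`-point
configuration minimizing the pairwise sum exceeds `rhoDiam G n` by at most `K / n`. -/
theorem exists_lintegral_min_le_rhoDiam {X : Type*} [TopologicalSpace X] [CompactSpace X]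
    [SecondCountableTopology X] [Nonempty X] [MeasurableSpace X] [BorelSpace X]
    (G : X → X → ℝ≥0∞) (hsymm : ∀ x y, G x y = G y x)
    (hcont : Continuous fun p : X × X => G p.1 p.2) {n : ℕ} (hn : 2 ≤ n) :
    ∃ μ : ProbabilityMeasure X, ∀ K : ℕ,
      ∫⁻ z, min (G z.1 z.2) K ∂(μ.prod μ : Measure (X × X)) ≤ K / n + rhoDiam G n := by
  have : NeZero n := ⟨by omega⟩
  obtain ⟨p, hp⟩ := exists_sum_eq_choose_mul_rhoDiam G hcont hn
  refine ⟨empiricalMeasure p, fun K ↦ ?_⟩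
  have hn0 : (n : ℝ≥0∞) ≠ 0 := by exact_mod_cast NeZero.ne n
  have hnt : (n : ℝ≥0∞) ≠ ∞ := ENNReal.natCast_ne_top n
  rw [lintegral_prod_empiricalMeasure p (hcont.measurable.min measurable_const),
    sum_sum_eq_sum_diag_add_two_mul (fun i j ↦ min (G (p i) (p j)) K)
      (fun i j ↦ by rw [hsymm])]
  have hdiag : ∑ i, min (G (p i) (p i)) (K : ℝ≥0∞) ≤ n * K := by
    simpa using Finset.sum_le_card_nsmul Finset.univ
      (fun i ↦ min (G (p i) (p i)) (K : ℝ≥0∞)) K fun i _ ↦ min_le_right _ _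
  have hoff : (∑ i, ∑ j, if i < j then min (G (p i) (p j)) (K : ℝ≥0∞) else 0) ≤
      (n.choose 2 : ℕ) * rhoDiam G n := by
    rw [← hp]
    refine Finset.sum_le_sum fun i _ ↦ Finset.sum_le_sum fun j _ ↦ ?_
    split_ifs
    exacts [min_le_left _ _, le_rfl]
  have hchoose : (2 : ℝ≥0∞) * (n.choose 2 : ℕ) ≤ n * n := by
    have : 2 * n.choose 2 ≤ n * n := by
      rw [Nat.choose_two_right]
      exact (Nat.mul_div_le _ _).trans (Nat.mul_le_mul_left _ (Nat.sub_le _ _))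
    exact_mod_cast this
  calc _ ≤ (n : ℝ≥0∞)⁻¹ * ((n : ℝ≥0∞)⁻¹ * (n * K + n * n * rhoDiam G n)) := by
        refine mul_le_mul_right (mul_le_mul_right (add_le_add hdiag ?_) _) _
        refine (mul_le_mul_right hoff 2).trans ?_
        rw [← mul_assoc]
        exact mul_le_mul_left hchoose _
    _ = _ := by
        rw [mul_assoc, ← mul_add, ENNReal.inv_mul_cancel_left hn0 hnt, mul_add,
          ENNReal.inv_mul_cancel_left hn0 hnt, ENNReal.div_eq_inv_mul]

theorem continuous_lintegral_prod_min {X : Type*} [TopologicalSpace X] [CompactSpace X]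
    [TopologicalSpace.PseudoMetrizableSpace X] [SecondCountableTopology X]
    [MeasurableSpace X] [BorelSpace X]
    (G : X → X → ℝ≥0∞) (hcont : Continuous fun p : X × X => G p.1 p.2) (K : ℕ) :
    Continuous fun μ : ProbabilityMeasure X ↦
      ∫⁻ z, min (G z.1 z.2) K ∂(μ.prod μ : Measure (X × X)) := by
  have hfin (z : X × X) : min (G z.1 z.2) (K : ℝ≥0∞) ≠ ∞ :=
    ((min_le_right _ _).trans_lt (ENNReal.natCast_lt_top K)).ne
  let f : C(X × X, ℝ≥0) := ⟨fun z ↦ (min (G z.1 z.2) (K : ℝ≥0∞)).toNNReal,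
    ENNReal.continuousOn_toNNReal.comp_continuous (hcont.min continuous_const) hfin⟩
  have hf (z : X × X) : min (G z.1 z.2) (K : ℝ≥0∞) = f z := (ENNReal.coe_toNNReal (hfin z)).symm
  simp_rw [hf]
  exact (ProbabilityMeasure.continuous_lintegral_continuousMap f).comp
    (ProbabilityMeasure.continuous_prod.comp (continuous_id.prodMk continuous_id))

theorem lintegral_le_of_forall_lintegral_min_le {α : Type*} [MeasurableSpace α] {μ : Measure α}
    {f : α → ℝ≥0∞} (hf : Measurable f) {C : ℝ≥0∞}
    (h : ∀ K : ℕ, ∫⁻ x, min (f x) K ∂μ ≤ C) : ∫⁻ x, f x ∂μ ≤ C := by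
  have hsup (x : α) : ⨆ K : ℕ, min (f x) (K : ℝ≥0∞) = f x := by
    rw [← inf_iSup_eq, ENNReal.iSup_natCast, inf_top_eq]
  calc ∫⁻ x, f x ∂μ = ∫⁻ x, ⨆ K : ℕ, min (f x) (K : ℝ≥0∞) ∂μ := by simp_rw [hsup]
    _ = ⨆ K : ℕ, ∫⁻ x, min (f x) (K : ℝ≥0∞) ∂μ :=
        lintegral_iSup (fun K ↦ hf.min measurable_const)
          fun K L hKL x ↦ min_le_min le_rfl (by exact_mod_cast hKL)
    _ ≤ C := iSup_le h

/-- On a nonempty compact metric space, for a symmetric continuous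
kernel with values in `[0,∞]`, the transfinite diameter dominates the minimal
energy over Borel probability measures. -/
theorem minimal_energy_le_transfinite_diameter
    {X : Type*} [MetricSpace X] [CompactSpace X] [Nonempty X]
    [MeasurableSpace X] [BorelSpace X]
    (G : X → X → ENNReal) (hsymm : ∀ x y, G x y = G y x)
    (hcont : Continuous fun p : X × X => G p.1 p.2) :
    (⨅ μ : ProbabilityMeasure X,
        ∫⁻ x, ∫⁻ y, G x y ∂(μ : Measure X) ∂(μ : Measure X)) ≤
      ⨆ (n : ℕ) (_ : 2 ≤ n), rhoDiam G n := by
  choose μ hμ using fun n : ℕ ↦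
    exists_lintegral_min_le_rhoDiam G hsymm hcont (n := n + 2) (by omega)
  obtain ⟨ν, -, hν⟩ := isCompact_univ.ultrafilter_le_nhds
    ((hyperfilter ℕ).map μ) (by simp)
  have hν' : Tendsto μ (hyperfilter ℕ) (𝓝 ν) := hν
  have hle : (hyperfilter ℕ : Filter ℕ) ≤ atTop := Nat.hyperfilter_le_atTop
  refine (iInf_le _ ν).trans ?_
  rw [← lintegral_prod (fun z : X × X ↦ G z.1 z.2) hcont.measurable.aemeasurable]
  refine lintegral_le_of_forall_lintegral_min_le hcont.measurable fun K ↦ ?_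
  have hlim : Tendsto (fun n : ℕ ↦ (K : ℝ≥0∞) / (n + 2 : ℕ) + ⨆ (n : ℕ) (_ : 2 ≤ n), rhoDiam G n)
      atTop (𝓝 (0 + ⨆ (n : ℕ) (_ : 2 ≤ n), rhoDiam G n)) := by
    refine Tendsto.add ?_ tendsto_const_nhds
    exact (ENNReal.Tendsto.const_div
      (ENNReal.tendsto_nat_nhds_top.comp (tendsto_add_atTop_nat 2))
      (.inr (ENNReal.natCast_ne_top K))).trans (by simp)
  rw [zero_add] at hlim
  refine le_of_tendsto_of_tendsto'
    (((continuous_lintegral_prod_min G hcont K).tendsto ν).comp hν') (hlim.mono_left hle)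
    fun n ↦ (hμ n K).trans ?_
  gcongr
  exact le_iSup₂_of_le (n + 2) (by omega) le_rfl
end

section
/- Let X be a nonempty compact metric space and G : X → X → [0,∞] a symmetric function that is continuous as a map X × X → [0,∞]. If the minimal energy ε(X) is finite, then there exists a Borel probability measure ν on X realizing the minimum: ∫∫ G(x,y) dν(x) dν(y) = ε(X). -/
open MeasureTheory

open scoped ENNReal NNReal BoundedContinuousFunction

namespace MeasureTheory.ProbabilityMeasure

/-- Integration of a continuous `[0,∞]`-valued function against a probability measure is lower
semicontinuous for the topology of weak convergence. -/
theorem lowerSemicontinuous_lintegral {Y : Type*} [TopologicalSpace Y] [MeasurableSpace Y]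
    [OpensMeasurableSpace Y] {f : Y → ℝ≥0∞} (hf : Continuous f) :
    LowerSemicontinuous fun μ : ProbabilityMeasure Y => ∫⁻ y, f y ∂(μ : Measure Y) := by
  have htop (n : ℕ) (y : Y) : min (f y) n ≠ ∞ :=
    ne_top_of_le_ne_top (ENNReal.natCast_ne_top n) (min_le_right _ _)
  have hmin (n : ℕ) : Continuous fun y => min (f y) (n : ℝ≥0∞) := hf.min continuous_const
  let g (n : ℕ) : Y →ᵇ ℝ≥0 := BoundedContinuousFunction.mkOfBound
    ⟨fun y => (min (f y) n).toNNReal,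
      ENNReal.continuousOn_toNNReal.comp_continuous (hmin n) (htop n)⟩ n (by
        have hle (z : Y) : (min (f z) (n : ℝ≥0∞)).toNNReal ≤ n := by
          simpa using ENNReal.toNNReal_mono (ENNReal.natCast_ne_top n) (min_le_right (f z) n)
        intro x y
        simpa [NNReal.dist_eq, Real.dist_eq] using Real.dist_le_of_mem_Icc (y' := (n : ℝ))
          ⟨NNReal.coe_nonneg _, NNReal.coe_le_coe.2 (hle x)⟩
          ⟨NNReal.coe_nonneg _, NNReal.coe_le_coe.2 (hle y)⟩)
  have hg (n : ℕ) (y : Y) : (g n y : ℝ≥0∞) = min (f y) n := ENNReal.coe_toNNReal (htop n y)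
  have hsup (μ : ProbabilityMeasure Y) :
      ∫⁻ y, f y ∂(μ : Measure Y) = ⨆ n, ∫⁻ y, g n y ∂(μ : Measure Y) := by
    simp_rw [hg]
    rw [← lintegral_iSup (fun n => (hmin n).measurable)
      (fun m n hmn y => min_le_min_left _ (by exact_mod_cast hmn))]
    congr! 2 with y
    rw [← inf_iSup_eq, ENNReal.iSup_natCast, inf_top_eq]
  simp_rw [hsup]
  refine lowerSemicontinuous_iSup fun n => Continuous.lowerSemicontinuous ?_
  exact continuous_lintegral_boundedContinuousFunction (g n)

end MeasureTheory.ProbabilityMeasure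

/-- On a nonempty compact metric space, for a symmetric continuous
kernel with values in `[0,∞]`, if the minimal energy over Borel probability
measures is finite then it is attained by some Borel probability measure. -/
theorem exists_minimizing_measure_of_minimal_energy_finite
    {X : Type*} [MetricSpace X] [CompactSpace X] [Nonempty X]
    [MeasurableSpace X] [BorelSpace X]
    (G : X → X → ENNReal) (hsymm : ∀ x y, G x y = G y x)
    (hcont : Continuous fun p : X × X => G p.1 p.2)
    (hfin : (⨅ μ : ProbabilityMeasure X,
        ∫⁻ x, ∫⁻ y, G x y ∂(μ : Measure X) ∂(μ : Measure X)) ≠ ⊤) :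
    ∃ ν : ProbabilityMeasure X,
      (∫⁻ x, ∫⁻ y, G x y ∂(ν : Measure X) ∂(ν : Measure X)) =
        ⨅ μ : ProbabilityMeasure X,
          ∫⁻ x, ∫⁻ y, G x y ∂(μ : Measure X) ∂(μ : Measure X) := by
  have henergy (μ : ProbabilityMeasure X) :
      ∫⁻ x, ∫⁻ y, G x y ∂(μ : Measure X) ∂(μ : Measure X) =
        ∫⁻ p : X × X, G p.1 p.2 ∂(μ.prod μ : Measure (X × X)) :=
    (lintegral_prod _ hcont.measurable.aemeasurable).symm
  simp_rw [henergy]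
  have hprod : Continuous fun μ : ProbabilityMeasure X => μ.prod μ :=
    ProbabilityMeasure.continuous_prod.comp (continuous_id.prodMk continuous_id)
  have hlsc := (ProbabilityMeasure.lowerSemicontinuous_lintegral hcont).comp hprod
  obtain ⟨ν, -, hν⟩ := (hlsc.lowerSemicontinuousOn Set.univ).exists_isMinOn
    ⟨diracProba (Classical.arbitrary X), Set.mem_univ _⟩ isCompact_univ
  exact ⟨ν, le_antisymm (le_iInf fun μ => hν (Set.mem_univ μ)) (iInf_le _ ν)⟩
end

section
/- Let X be a nonempty compact metric space and G : X → X → [0,∞] a symmetric function that is continuous as a map X × X → [0,∞]. Let ν be a Borel probability measure on X whose energy E = ∫∫ G dν dν is finite and minimal among the energies of all Borel probability measures on X. Then the potential of ν is bounded by E on the support of ν: for every x ∈ X such that every open neighborhood of x has positive ν-measure, G_ν(x) = ∫ G(x,y) dν(y) ≤ E. -/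
open MeasureTheory

open Filter Topology

lemma isClosed_potential_le {X : Type*} [MetricSpace X] [CompactSpace X]
    [MeasurableSpace X] [BorelSpace X] {G : X → X → ENNReal}
    (hcont : Continuous fun p : X × X => G p.1 p.2) (ν : Measure X) (E : ENNReal) :
    IsClosed {x | ∫⁻ y, G x y ∂ν ≤ E} := by
  apply IsSeqClosed.isClosed
  intro u x hu hx
  have hlim (y : X) : liminf (fun n => G (u n) y) atTop = G x y :=
    ((hcont.tendsto (x, y)).comp (hx.prodMk_nhds tendsto_const_nhds)).liminf_eq
  calc ∫⁻ y, G x y ∂ν = ∫⁻ y, liminf (fun n => G (u n) y) atTop ∂ν := by simp_rw [hlim]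
    _ ≤ liminf (fun n => ∫⁻ y, G (u n) y ∂ν) atTop :=
        lintegral_liminf_le fun n => (hcont.comp (Continuous.prodMk_right (u n))).measurable
    _ ≤ liminf (fun _ : ℕ => E) atTop := liminf_le_liminf (Eventually.of_forall hu)
    _ = E := by simp

lemma mul_sq_mass_le_energy {X : Type*} [MeasurableSpace X] {G : X → X → ENNReal} {E : ENNReal}
    (hmin : ∀ μ : ProbabilityMeasure X,
      E ≤ ∫⁻ x, ∫⁻ y, G x y ∂(μ : Measure X) ∂(μ : Measure X))
    (hG : Measurable (Function.uncurry G)) (μ : Measure X) [IsFiniteMeasure μ] :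
    E * μ Set.univ ^ 2 ≤ ∫⁻ x, ∫⁻ y, G x y ∂μ ∂μ := by
  rcases eq_or_ne (μ Set.univ) 0 with h0 | h0
  · simp [h0]
  have htop : μ Set.univ ≠ ⊤ := measure_ne_top μ _
  have : NeZero μ := ⟨fun h => h0 (by simp [h])⟩
  have h := hmin ⟨(μ Set.univ)⁻¹ • μ, inferInstance⟩
  simp only [ProbabilityMeasure.coe_mk, lintegral_smul_measure, smul_eq_mul] at h
  rw [lintegral_const_mul _ hG.lintegral_prod_right] at h
  calc E * μ Set.univ ^ 2
      ≤ ((μ Set.univ)⁻¹ * ((μ Set.univ)⁻¹ * ∫⁻ x, ∫⁻ y, G x y ∂μ ∂μ)) * μ Set.univ ^ 2 := by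
        gcongr
    _ = (μ Set.univ * (μ Set.univ)⁻¹) ^ 2 * ∫⁻ x, ∫⁻ y, G x y ∂μ ∂μ := by ring
    _ = ∫⁻ x, ∫⁻ y, G x y ∂μ ∂μ := by simp [ENNReal.mul_inv_cancel h0 htop]

lemma lintegral_lintegral_add_smul {X : Type*} [MeasurableSpace X] {G : X → X → ENNReal}
    (hsymm : ∀ x y, G x y = G y x) (hG : Measurable (Function.uncurry G))
    (κ ρ : Measure X) [SFinite κ] [SFinite ρ] (s : ENNReal) :
    ∫⁻ x, ∫⁻ y, G x y ∂(κ + s • ρ) ∂(κ + s • ρ) =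
      ∫⁻ x, ∫⁻ y, G x y ∂κ ∂κ + 2 * s * ∫⁻ x, ∫⁻ y, G x y ∂κ ∂ρ +
        s ^ 2 * ∫⁻ x, ∫⁻ y, G x y ∂ρ ∂ρ := by
  have hκ : Measurable fun x => ∫⁻ y, G x y ∂κ := hG.lintegral_prod_right
  have hρ : Measurable fun x => ∫⁻ y, G x y ∂ρ := hG.lintegral_prod_right
  have hswap : ∫⁻ x, ∫⁻ y, G x y ∂ρ ∂κ = ∫⁻ x, ∫⁻ y, G x y ∂κ ∂ρ := by
    rw [lintegral_lintegral_swap hG.aemeasurable]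
    simp_rw [hsymm]
  simp only [lintegral_add_measure, lintegral_smul_measure, smul_eq_mul]
  rw [lintegral_add_left hκ, lintegral_add_left hκ, lintegral_const_mul _ hρ,
    lintegral_const_mul _ hρ, hswap]
  ring

lemma le_of_quadratic_nonneg_left {b d E u : ℝ}
    (h : ∀ t, 0 < t → t < 1 → 0 ≤ t ^ 2 * (d - E * u ^ 2) - 2 * t * (b + d - E * u)) :
    b + d ≤ E * u := by
  by_contra! hlt
  set δ := b + d - E * u with hδ
  set K := d - E * u ^ 2
  have hδ0 : 0 < δ := by linarith
  have hK := abs_nonneg K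
  have hden : 0 < δ + |K| + 1 := by positivity
  have ht0 : 0 < δ / (δ + |K| + 1) := by positivity
  have h1 := h _ ht0 (by rw [div_lt_one hden]; linarith)
  set t := δ / (δ + |K| + 1)
  have hmul : t * (δ + |K| + 1) = δ := div_mul_cancel₀ _ hden.ne'
  have h2 : 0 ≤ t * K - 2 * δ := by
    by_contra! hneg
    nlinarith [mul_neg_of_pos_of_neg ht0 hneg]
  nlinarith [mul_le_mul_of_nonneg_left (le_abs_self K) ht0.le, mul_pos ht0 hδ0]

lemma setLIntegral_potential_le {X : Type*} [MeasurableSpace X]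
    {G : X → X → ENNReal} (hsymm : ∀ x y, G x y = G y x)
    (hG : Measurable (Function.uncurry G)) (ν : Measure X) [IsProbabilityMeasure ν]
    (hfin : ∫⁻ x, ∫⁻ y, G x y ∂ν ∂ν ≠ ⊤)
    (hmin : ∀ μ : ProbabilityMeasure X, ∫⁻ x, ∫⁻ y, G x y ∂ν ∂ν ≤
      ∫⁻ x, ∫⁻ y, G x y ∂(μ : Measure X) ∂(μ : Measure X))
    {U : Set X} (hU : MeasurableSet U) :
    ∫⁻ x in U, ∫⁻ y, G x y ∂ν ∂ν ≤ (∫⁻ x, ∫⁻ y, G x y ∂ν ∂ν) * ν U := by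
  set E := ∫⁻ x, ∫⁻ y, G x y ∂ν ∂ν with hE
  set ρ := ν.restrict U with hρ
  set κ := ν.restrict Uᶜ with hκ
  have hν : κ + ρ = ν := by rw [add_comm, hρ, hκ, Measure.restrict_add_restrict_compl hU]
  have hform := lintegral_lintegral_add_smul hsymm hG κ ρ
  have hE' : E = ∫⁻ x, ∫⁻ y, G x y ∂κ ∂κ + 2 * ∫⁻ x, ∫⁻ y, G x y ∂κ ∂ρ +
      ∫⁻ x, ∫⁻ y, G x y ∂ρ ∂ρ := by
    simpa only [one_smul, hν, mul_one, one_pow, one_mul] using hform 1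
  have hF : ∫⁻ x, ∫⁻ y, G x y ∂ν ∂ρ =
      ∫⁻ x, ∫⁻ y, G x y ∂κ ∂ρ + ∫⁻ x, ∫⁻ y, G x y ∂ρ ∂ρ := by
    conv_lhs => rw [← hν]
    simp only [lintegral_add_measure]
    exact lintegral_add_left hG.lintegral_prod_right _
  have hvar (s : ENNReal) (hs : s ≠ ⊤) : E * (ν Uᶜ + s * ν U) ^ 2 ≤
      ∫⁻ x, ∫⁻ y, G x y ∂κ ∂κ + 2 * s * ∫⁻ x, ∫⁻ y, G x y ∂κ ∂ρ +
        s ^ 2 * ∫⁻ x, ∫⁻ y, G x y ∂ρ ∂ρ := by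
    have : IsFiniteMeasure (s • ρ) := Measure.smul_finite ρ hs
    have h := mul_sq_mass_le_energy hmin hG (κ + s • ρ)
    rw [hform s] at h
    simpa [hρ, hκ] using h
  have hmass : ν Uᶜ + ν U = 1 := by rw [add_comm, measure_add_measure_compl hU, measure_univ]
  rw [hF]
  generalize ∫⁻ x, ∫⁻ y, G x y ∂κ ∂κ = a at *
  generalize ∫⁻ x, ∫⁻ y, G x y ∂κ ∂ρ = b at *
  generalize ∫⁻ x, ∫⁻ y, G x y ∂ρ ∂ρ = d at *
  have hu : ν U ≠ ⊤ := measure_ne_top ν U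
  have hm : ν Uᶜ ≠ ⊤ := measure_ne_top ν Uᶜ
  generalize ν U = u at *
  generalize ν Uᶜ = m at *
  clear_value E
  have hd : d ≠ ⊤ := by rintro rfl; simp_all
  have ha : a ≠ ⊤ := by rintro rfl; simp_all
  have hb : b ≠ ⊤ := by rintro rfl; simp_all [ENNReal.mul_top]
  lift a to NNReal using ha
  lift b to NNReal using hb
  lift d to NNReal using hd
  lift u to NNReal using hu
  lift m to NNReal using hm
  lift E to NNReal using hfin
  have hE'' : (E : ℝ) = a + 2 * b + d := by exact_mod_cast hE'
  have hmass' : (m : ℝ) + u = 1 := by exact_mod_cast hmass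
  have hfinal : (b : ℝ) + d ≤ E * u := by
    apply le_of_quadratic_nonneg_left
    intro t ht0 ht1
    obtain ⟨s, hs⟩ : ∃ s : NNReal, (s : ℝ) = 1 - t := ⟨⟨1 - t, by linarith⟩, rfl⟩
    have h := hvar s ENNReal.coe_ne_top
    have h' : (E : ℝ) * (m + s * u) ^ 2 ≤ a + 2 * s * b + s ^ 2 * d := by
      exact_mod_cast h
    rw [hs] at h'
    have hm' : (m : ℝ) + (1 - t) * u = 1 - t * u := by linarith
    rw [hm'] at h'
    linarith
  exact_mod_cast hfinal

/-- If `ν` is a Borel probability measure of finite minimal energy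
`E` for a symmetric continuous kernel `G` on a nonempty compact metric space,
then the potential `G_ν(x) = ∫ G(x,y) dν(y)` is bounded by `E` at every point
of the support of `ν`. -/
theorem potential_le_energy_on_support
    {X : Type*} [MetricSpace X] [CompactSpace X] [Nonempty X]
    [MeasurableSpace X] [BorelSpace X]
    (G : X → X → ENNReal) (hsymm : ∀ x y, G x y = G y x)
    (hcont : Continuous fun p : X × X => G p.1 p.2)
    (ν : ProbabilityMeasure X) (E : ENNReal)
    (hE : E = ∫⁻ x, ∫⁻ y, G x y ∂(ν : Measure X) ∂(ν : Measure X))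
    (hEfin : E ≠ ⊤)
    (hmin : ∀ μ : ProbabilityMeasure X,
      E ≤ ∫⁻ x, ∫⁻ y, G x y ∂(μ : Measure X) ∂(μ : Measure X)) :
    ∀ x : X, (∀ U : Set X, IsOpen U → x ∈ U → 0 < (ν : Measure X) U) →
      (∫⁻ y, G x y ∂(ν : Measure X)) ≤ E := by
  intro x hx
  by_contra hlt
  have hG : Measurable (Function.uncurry G) := hcont.measurable
  have hopen := (isClosed_potential_le hcont (ν : Measure X) E).isOpen_compl
  have hpos := hx _ hopen hlt
  set U := {x | ∫⁻ y, G x y ∂(ν : Measure X) ≤ E}ᶜ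
  have hle := setLIntegral_potential_le hsymm hG (ν : Measure X) (hE ▸ hEfin) (hE ▸ hmin)
    hopen.measurableSet
  rw [← hE] at hle
  have hstrict : ∫⁻ _ in U, E ∂(ν : Measure X) <
      ∫⁻ x in U, ∫⁻ y, G x y ∂(ν : Measure X) ∂(ν : Measure X) := by
    refine setLIntegral_strict_mono hopen.measurableSet hpos.ne' hG.lintegral_prod_right ?_
      (Eventually.of_forall fun y hy => not_le.mp hy)
    simpa using ENNReal.mul_ne_top hEfin (measure_ne_top _ _)
  rw [setLIntegral_const] at hstrict
  exact hstrict.not_ge hle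
end

section
/- (Continuity principle for potentials.) Let m ≥ 3 be an integer, μ a finite Borel measure on ℝ^m, and S a compact subset of ℝ^m with μ(ℝ^m ∖ S) = 0. Define the potential U_μ(x) = ∫ ‖x − y‖^{−(m−2)} dμ(y) ∈ [0,∞]. If U_μ(x) < ∞ for every x ∈ S and the restriction of U_μ to S is continuous, then U_μ is finite and continuous on all of ℝ^m. -/
open MeasureTheory

/-- The Newtonian potential `U_μ(x) = ∫ ‖x − y‖^{−(m−2)} dμ(y)` of a measure
`μ` on `ℝ^m`, with values in `[0,∞]`. -/
noncomputable def newtonPot (m : ℕ) (μ : Measure (EuclideanSpace ℝ (Fin m)))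
    (x : EuclideanSpace ℝ (Fin m)) : ENNReal :=
  ∫⁻ y, (edist x y) ^ (-((m : ℝ) - 2)) ∂μ

open Filter Topology
open scoped ENNReal

namespace RieszPotential

variable {E : Type*} [MetricSpace E]

theorem continuous_kernel_left (a : ℝ) (y : E) : Continuous fun x : E => edist x y ^ a :=
  (ENNReal.continuous_rpow_const (y := a)).comp (continuous_id.edist continuous_const)

theorem continuous_kernel_right (a : ℝ) (x : E) : Continuous fun y : E => edist x y ^ a :=
  (ENNReal.continuous_rpow_const (y := a)).comp (continuous_const.edist continuous_id)

/-- The kernel at `x` is controlled on `S` by the kernel at a point of `S` nearest to `x`. -/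
theorem exists_kernel_le {S : Set E} (hS : IsCompact S) (hne : S.Nonempty) {p : ℝ} (hp : 0 ≤ p)
    (x : E) : ∃ x' ∈ S, ∀ y ∈ S, edist x y ^ (-p) ≤ 2 ^ p * edist x' y ^ (-p) := by
  obtain ⟨x', hx', hmin⟩ := hS.exists_isMinOn hne
    (f := fun z => edist x z) (continuous_const.edist continuous_id).continuousOn
  refine ⟨x', hx', fun y hy => ?_⟩
  have h : edist x' y ≤ 2 * edist x y := calc
    edist x' y ≤ edist x' x + edist x y := edist_triangle _ _ _
    _ = edist x x' + edist x y := by rw [edist_comm]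
    _ ≤ edist x y + edist x y := by gcongr; exact hmin hy
    _ = 2 * edist x y := (two_mul _).symm
  have h' : edist x' y ^ p ≤ 2 ^ p * edist x y ^ p := by
    rw [← ENNReal.mul_rpow_of_nonneg _ _ hp]
    exact ENNReal.rpow_le_rpow h hp
  have h0 : (2 : ℝ≥0∞) ^ p ≠ 0 := by simp [ENNReal.rpow_eq_zero_iff]
  have ht : (2 : ℝ≥0∞) ^ p ≠ ⊤ := ENNReal.rpow_ne_top_of_nonneg hp (by simp)
  rw [ENNReal.rpow_neg, ENNReal.rpow_neg, ← div_eq_mul_inv, ENNReal.le_div_iff_mul_le]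
  · rw [← ENNReal.div_eq_inv_mul]
    exact ENNReal.div_le_of_le_mul h'
  · right; exact h0
  · right; exact ht

variable [MeasurableSpace E] {μ : Measure E} {S : Set E} {p : ℝ}

theorem lintegral_kernel_ne_top (hS : IsCompact S) (hne : S.Nonempty) (hμS : ∀ᵐ y ∂μ, y ∈ S)
    (hp : 0 ≤ p) (hfin : ∀ x ∈ S, ∫⁻ y, edist x y ^ (-p) ∂μ ≠ ⊤) (x : E) :
    ∫⁻ y, edist x y ^ (-p) ∂μ ≠ ⊤ := by
  have ht : (2 : ℝ≥0∞) ^ p ≠ ⊤ := ENNReal.rpow_ne_top_of_nonneg hp (by simp)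
  obtain ⟨x', hx', h⟩ := exists_kernel_le hS hne hp x
  refine ne_top_of_le_ne_top (ENNReal.mul_ne_top ht (hfin x' hx')) ?_
  rw [← lintegral_const_mul' _ _ ht]
  exact lintegral_mono_ae (hμS.mono h)

variable [OpensMeasurableSpace E]

theorem continuous_lintegral_min [IsFiniteMeasure μ] (a : ℝ) {M : ℝ≥0∞} (hM : M ≠ ⊤) :
    Continuous fun x : E => ∫⁻ y, min (edist x y ^ a) M ∂μ := by
  refine continuous_iff_continuousAt.2 fun x => ?_
  refine tendsto_lintegral_filter_of_dominated_convergence (fun _ => M) ?_ ?_ ?_ ?_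
  · exact .of_forall fun z => ((continuous_kernel_right a z).min continuous_const).measurable
  · exact .of_forall fun z => .of_forall fun y => min_le_right _ _
  · simpa using ENNReal.mul_ne_top hM (measure_ne_top μ _)
  · exact .of_forall fun y => ((continuous_kernel_left a y).min continuous_const).tendsto x

theorem lintegral_tsub_add_lintegral_min (a : ℝ) (M : ℝ≥0∞) (x : E) :
    (∫⁻ y, (edist x y ^ a - M) ∂μ) + ∫⁻ y, min (edist x y ^ a) M ∂μ
      = ∫⁻ y, edist x y ^ a ∂μ := by
  rw [← lintegral_add_right _ ((continuous_kernel_right a x).min continuous_const).measurable]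
  simp only [tsub_add_min]

theorem tendsto_lintegral_tsub_nat (a : ℝ) {x : E} (hx : ∫⁻ y, edist x y ^ a ∂μ ≠ ⊤) :
    Tendsto (fun n : ℕ => ∫⁻ y, (edist x y ^ a - n) ∂μ) atTop (𝓝 0) := by
  have hm : Measurable fun y => edist x y ^ a := (continuous_kernel_right a x).measurable
  rw [← lintegral_zero (μ := μ)]
  refine tendsto_lintegral_of_dominated_convergence (fun y => edist x y ^ a)
    (fun n => hm.sub_const _) (fun n => .of_forall fun y => tsub_le_self) hx ?_
  filter_upwards [ae_lt_top hm hx] with y hy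
  obtain ⟨N, hN⟩ := ENNReal.exists_nat_gt hy.ne
  refine tendsto_const_nhds.congr' ?_
  filter_upwards [eventually_ge_atTop N] with n hn
  exact (tsub_eq_zero_of_le (hN.le.trans (by exact_mod_cast hn))).symm

/-- Dini's theorem for the truncated potentials on a compact set. -/
theorem exists_nat_forall_lintegral_tsub_le [IsFiniteMeasure μ] (a : ℝ)
    (hS : IsCompact S) (hfin : ∀ x ∈ S, ∫⁻ y, edist x y ^ a ∂μ ≠ ⊤)
    (hcont : ContinuousOn (fun x => ∫⁻ y, edist x y ^ a ∂μ) S) {ε : ℝ≥0∞} (hε : 0 < ε) :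
    ∃ n : ℕ, ∀ x ∈ S, ∫⁻ y, (edist x y ^ a - n) ∂μ ≤ ε := by
  have hmono : ∀ (x : E) {n k : ℕ}, n ≤ k →
      ∫⁻ y, (edist x y ^ a - k) ∂μ ≤ ∫⁻ y, (edist x y ^ a - n) ∂μ := fun x n k hnk =>
    lintegral_mono fun y => tsub_le_tsub_left (by exact_mod_cast hnk) _
  refine hS.induction_on (p := fun s => ∃ n : ℕ, ∀ x ∈ s, ∫⁻ y, (edist x y ^ a - n) ∂μ ≤ ε)
    ⟨0, by simp⟩ (fun s t hst ⟨n, hn⟩ => ⟨n, fun x hx => hn x (hst hx)⟩) ?_ ?_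
  · rintro s t ⟨n, hn⟩ ⟨k, hk⟩
    refine ⟨max n k, fun x hx => ?_⟩
    rcases hx with hx | hx
    · exact (hmono x (le_max_left _ _)).trans (hn x hx)
    · exact (hmono x (le_max_right _ _)).trans (hk x hx)
  · intro x hx
    obtain ⟨n, hn⟩ := ((tendsto_lintegral_tsub_nat a (hfin x hx)).eventually_lt_const hε).exists
    have hminfin : ∀ z ∈ S, ∫⁻ y, min (edist z y ^ a) n ∂μ ≠ ⊤ := fun z hz =>
      ne_top_of_le_ne_top (hfin z hz) (lintegral_mono fun y => min_le_left _ _)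
    have heq : ∀ z ∈ S, ∫⁻ y, (edist z y ^ a - n) ∂μ
        = (∫⁻ y, edist z y ^ a ∂μ) - ∫⁻ y, min (edist z y ^ a) n ∂μ := fun z hz =>
      ENNReal.eq_sub_of_add_eq (hminfin z hz) (lintegral_tsub_add_lintegral_min a n z)
    have hlim := ENNReal.Tendsto.sub (hcont x hx)
      ((continuous_lintegral_min (μ := μ) a (ENNReal.natCast_ne_top n)).continuousWithinAt
        (s := S) (x := x)) (Or.inl (hfin x hx))
    rw [← heq x hx] at hlim
    refine ⟨{z | z ∈ S → ∫⁻ y, (edist z y ^ a - n) ∂μ ≤ ε} ∩ S, ?_, n, fun z hz => hz.1 hz.2⟩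
    filter_upwards [hlim.eventually_lt_const hn, self_mem_nhdsWithin] with z hz hzS
    exact ⟨fun _ => (heq z hzS).trans_le hz.le, hzS⟩

/-- The truncated potentials converge uniformly on the whole space. -/
theorem exists_forall_lintegral_tsub_le [IsFiniteMeasure μ] (hS : IsCompact S)
    (hne : S.Nonempty) (hμS : ∀ᵐ y ∂μ, y ∈ S) (hp : 0 ≤ p)
    (hfin : ∀ x ∈ S, ∫⁻ y, edist x y ^ (-p) ∂μ ≠ ⊤)
    (hcont : ContinuousOn (fun x => ∫⁻ y, edist x y ^ (-p) ∂μ) S) {ε : ℝ≥0∞} (hε : 0 < ε) :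
    ∃ M : ℝ≥0∞, M ≠ ⊤ ∧ ∀ x, ∫⁻ y, (edist x y ^ (-p) - M) ∂μ ≤ ε := by
  have ht : (2 : ℝ≥0∞) ^ p ≠ ⊤ := ENNReal.rpow_ne_top_of_nonneg hp (by simp)
  obtain ⟨n, hn⟩ := exists_nat_forall_lintegral_tsub_le (-p) hS hfin hcont
    (ENNReal.div_pos hε.ne' ht)
  refine ⟨2 ^ p * n, ENNReal.mul_ne_top ht (ENNReal.natCast_ne_top n), fun x => ?_⟩
  obtain ⟨x', hx', h⟩ := exists_kernel_le hS hne hp x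
  calc ∫⁻ y, (edist x y ^ (-p) - 2 ^ p * n) ∂μ
      ≤ ∫⁻ y, 2 ^ p * (edist x' y ^ (-p) - n) ∂μ := by
        refine lintegral_mono_ae (hμS.mono fun y hy => ?_)
        rw [ENNReal.mul_sub fun _ _ => ht]
        exact tsub_le_tsub_right (h y hy) _
    _ = 2 ^ p * ∫⁻ y, (edist x' y ^ (-p) - n) ∂μ := lintegral_const_mul' _ _ ht
    _ ≤ 2 ^ p * (ε / 2 ^ p) := by gcongr; exact hn x' hx'
    _ ≤ ε := ENNReal.mul_div_le

theorem continuous_lintegral_kernel [IsFiniteMeasure μ] (hS : IsCompact S)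
    (hne : S.Nonempty) (hμS : ∀ᵐ y ∂μ, y ∈ S) (hp : 0 ≤ p)
    (hfin : ∀ x ∈ S, ∫⁻ y, edist x y ^ (-p) ∂μ ≠ ⊤)
    (hcont : ContinuousOn (fun x => ∫⁻ y, edist x y ^ (-p) ∂μ) S) :
    Continuous fun x => ∫⁻ y, edist x y ^ (-p) ∂μ := by
  have hfin' := lintegral_kernel_ne_top hS hne hμS hp hfin
  refine continuous_iff_continuousAt.2 fun x => (ENNReal.tendsto_nhds (hfin' x)).2 fun ε hε => ?_
  have hε2 : 0 < ε / 2 := ENNReal.half_pos hε.ne'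
  obtain ⟨M, hM, hr⟩ := exists_forall_lintegral_tsub_le hS hne hμS hp hfin hcont hε2
  have hle : ∀ z, ∫⁻ y, min (edist z y ^ (-p)) M ∂μ ≤ ∫⁻ y, edist z y ^ (-p) ∂μ := fun z =>
    lintegral_mono fun y => min_le_left _ _
  have hge : ∀ z, ∫⁻ y, edist z y ^ (-p) ∂μ
      ≤ ε / 2 + ∫⁻ y, min (edist z y ^ (-p)) M ∂μ := fun z => by
    rw [← lintegral_tsub_add_lintegral_min (-p) M z]
    gcongr
    exact hr z
  have hc := (continuous_lintegral_min (μ := μ) (-p) hM).tendsto x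
  filter_upwards [(ENNReal.tendsto_nhds (ne_top_of_le_ne_top (hfin' x) (hle x))).1 hc _ hε2]
    with z hz
  constructor
  · rw [tsub_le_iff_right]
    calc ∫⁻ y, edist x y ^ (-p) ∂μ
        ≤ ε / 2 + ∫⁻ y, min (edist x y ^ (-p)) M ∂μ := hge x
      _ ≤ ε / 2 + ((∫⁻ y, min (edist z y ^ (-p)) M ∂μ) + ε / 2) := by
        gcongr; exact tsub_le_iff_right.1 hz.1
      _ = (∫⁻ y, min (edist z y ^ (-p)) M ∂μ) + ε := by
        rw [add_left_comm, ENNReal.add_halves]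
      _ ≤ _ := by gcongr; exact min_le_left _ _
  · calc ∫⁻ y, edist z y ^ (-p) ∂μ
        ≤ ε / 2 + ∫⁻ y, min (edist z y ^ (-p)) M ∂μ := hge z
      _ ≤ ε / 2 + ((∫⁻ y, min (edist x y ^ (-p)) M ∂μ) + ε / 2) := by
        gcongr; exact hz.2
      _ = (∫⁻ y, min (edist x y ^ (-p)) M ∂μ) + ε := by
        rw [add_left_comm, ENNReal.add_halves]
      _ ≤ _ := by gcongr; exact min_le_left _ _

end RieszPotential

/-- continuity principle: if a finite Borel measure `μ` on `ℝ^m`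
(`m ≥ 3`) is carried by a compact set `S`, its potential is finite on `S` and
its restriction to `S` is continuous, then the potential is finite and
continuous on all of `ℝ^m`. -/
theorem continuity_principle_for_potentials
    (m : ℕ) (hm : 3 ≤ m)
    (μ : Measure (EuclideanSpace ℝ (Fin m))) [IsFiniteMeasure μ]
    (S : Set (EuclideanSpace ℝ (Fin m))) (hS : IsCompact S) (hμS : μ Sᶜ = 0)
    (hfin : ∀ x ∈ S, newtonPot m μ x ≠ ⊤)
    (hcont : ContinuousOn (newtonPot m μ) S) :
    (∀ x, newtonPot m μ x ≠ ⊤) ∧ Continuous (newtonPot m μ) := by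
  have hp : (0 : ℝ) ≤ (m : ℝ) - 2 := by
    have : (3 : ℝ) ≤ m := by exact_mod_cast hm
    linarith
  rcases S.eq_empty_or_nonempty with rfl | hne
  · have hμ : μ = 0 := by simpa using hμS
    have h0 : newtonPot m μ = fun _ => 0 := by
      funext x
      simp [newtonPot, hμ]
    rw [h0]
    exact ⟨fun _ => ENNReal.zero_ne_top, continuous_const⟩
  · have hae : ∀ᵐ y ∂μ, y ∈ S := hμS
    exact ⟨RieszPotential.lintegral_kernel_ne_top hS hne hae hp hfin,
      RieszPotential.continuous_lintegral_kernel hS hne hae hp hfin hcont⟩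
end

section
/- Let m ≥ 3 be an integer, μ a finite Borel measure on ℝ^m, and S a compact subset of ℝ^m with μ(ℝ^m ∖ S) = 0, and suppose that the potential U_μ(x) = ∫ ‖x − y‖^{−(m−2)} dμ(y) is finite at every x ∈ S. Then for every ε > 0 there exists a compact set C ⊆ S with μ(S ∖ C) < ε such that the potential U_{μ|C} of the restricted measure μ|C (defined by (μ|C)(A) = μ(A ∩ C)) is finite and continuous on all of ℝ^m. -/
open MeasureTheory

open Filter Topology Metric Set
open scoped ENNReal NNReal

section RieszPotential

theorem lintegral_ofReal_rpow_neg_lt_top {s : ℝ} {X : Type*} [MeasurableSpace X]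
    (ν : Measure X) [IsFiniteMeasure ν] {r : ℝ} (hr : 0 < r) :
    ∫⁻ _, ENNReal.ofReal r ^ (-s) ∂ν < ⊤ := by
  rw [lintegral_const]
  refine ENNReal.mul_lt_top ?_ (measure_lt_top _ _)
  simp [ENNReal.rpow_neg, hr, ENNReal.rpow_eq_zero_iff, pos_iff_ne_zero]

variable {X : Type*} [MetricSpace X] {s : ℝ}

theorem max_edist_rpow_neg_le (hs : 0 ≤ s) (r : ℝ) (x y : X) :
    max (edist x y) (ENNReal.ofReal r) ^ (-s) ≤ ENNReal.ofReal r ^ (-s) := by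
  rw [ENNReal.rpow_neg, ENNReal.rpow_neg]
  gcongr
  exact le_max_right _ _

variable [MeasurableSpace X]

theorem lintegral_max_edist_rpow_le (hs : 0 ≤ s) (ν : Measure X) (r : ℝ) (x : X) :
    ∫⁻ y, max (edist x y) (ENNReal.ofReal r) ^ (-s) ∂ν ≤ ∫⁻ y, edist x y ^ (-s) ∂ν := by
  refine lintegral_mono fun y ↦ ?_
  rw [ENNReal.rpow_neg, ENNReal.rpow_neg]
  gcongr
  exact le_max_left _ _

theorem lintegral_max_edist_rpow_lt_top (hs : 0 ≤ s) (ν : Measure X) [IsFiniteMeasure ν] {r : ℝ}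
    (hr : 0 < r) (x : X) : ∫⁻ y, max (edist x y) (ENNReal.ofReal r) ^ (-s) ∂ν < ⊤ :=
  (lintegral_mono fun y ↦ max_edist_rpow_neg_le hs r x y).trans_lt
    (lintegral_ofReal_rpow_neg_lt_top ν hr)

variable [BorelSpace X]

/-- If a Riesz potential is finite at `x`, the contribution of small balls around `x` vanishes
in the limit. -/
theorem tendsto_setLIntegral_closedBall_edist_rpow (hs : 0 < s) {μ : Measure X}
    [IsFiniteMeasure μ] {x : X} (hx : ∫⁻ y, edist x y ^ (-s) ∂μ ≠ ⊤) {r : ℕ → ℝ}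
    (hr : ∀ n, 0 ≤ r n) (hr0 : Tendsto r atTop (𝓝 0)) :
    Tendsto (fun n ↦ ∫⁻ y in closedBall x (r n), edist x y ^ (-s) ∂μ) atTop (𝓝 0) := by
  have hmeas : Measurable fun y ↦ edist x y ^ (-s) := by fun_prop
  have hsing : μ {x} = 0 := by
    have h := measure_eq_top_of_lintegral_ne_top hmeas.aemeasurable hx
    refine measure_mono_null ?_ h
    rintro y rfl
    simp [hs]
  apply tendsto_setLIntegral_zero hx
  have h := (tendsto_measure_cthickening_of_isClosed (μ := μ) (s := {x})
    ⟨1, one_pos, measure_ne_top _ _⟩ isClosed_singleton).comp hr0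
  rw [hsing] at h
  refine h.congr fun n ↦ ?_
  simp [cthickening_singleton x (hr n)]

/-- A bound on the contributions of balls centred on a compact set `C` to the Riesz potential
propagates to balls with arbitrary centres, for the measure restricted to `C`. -/
theorem setLIntegral_closedBall_edist_rpow_restrict_le (hs : 0 < s) {μ : Measure X} {C : Set X}
    (hC : IsCompact C) {r : ℝ} {b : ℝ≥0∞}
    (hb : ∀ x ∈ C, ∫⁻ y in closedBall x (2 * r), edist x y ^ (-s) ∂μ ≤ b) (x : X) :
    ∫⁻ y in closedBall x r, edist x y ^ (-s) ∂(μ.restrict C) ≤ 2 ^ s * b := by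
  rcases C.eq_empty_or_nonempty with rfl | hne
  · simp
  obtain ⟨z, hzC, hz⟩ := hC.exists_infEDist_eq_edist hne x
  have hle : ∀ y ∈ C, edist z y ≤ 2 * edist x y := fun y hy ↦
    calc edist z y ≤ edist z x + edist x y := edist_triangle _ _ _
      _ ≤ edist x y + edist x y := by
        gcongr
        rw [edist_comm, ← hz]
        exact infEDist_le_edist_of_mem hy
      _ = 2 * edist x y := (two_mul _).symm
  have hker : ∀ y ∈ C, edist x y ^ (-s) ≤ 2 ^ s * edist z y ^ (-s) := fun y hy ↦ by
    have h2 : (2 : ℝ≥0∞) ^ s ≠ 0 := by simp [ENNReal.rpow_eq_zero_iff]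
    have h2t : (2 : ℝ≥0∞) ^ s ≠ ⊤ := ENNReal.rpow_ne_top_of_nonneg hs.le (by simp)
    calc edist x y ^ (-s) = 2 ^ s * (2 * edist x y) ^ (-s) := by
          rw [ENNReal.mul_rpow_of_ne_top (by simp) (edist_ne_top _ _), ENNReal.rpow_neg 2,
            ← mul_assoc, ENNReal.mul_inv_cancel h2 h2t, one_mul]
      _ ≤ 2 ^ s * edist z y ^ (-s) := by
          gcongr 2 ^ s * ?_
          rw [ENNReal.rpow_neg, ENNReal.rpow_neg]
          gcongr
          exact hle y hy
  rw [Measure.restrict_restrict measurableSet_closedBall]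
  calc ∫⁻ y in closedBall x r ∩ C, edist x y ^ (-s) ∂μ
      ≤ ∫⁻ y in closedBall x r ∩ C, 2 ^ s * edist z y ^ (-s) ∂μ :=
        setLIntegral_mono (by fun_prop) fun y hy ↦ hker y hy.2
    _ ≤ ∫⁻ y in closedBall z (2 * r), 2 ^ s * edist z y ^ (-s) ∂μ := by
        refine lintegral_mono_set fun y hy ↦ ?_
        have h := hle y hy.2
        have hr : 0 ≤ r := dist_nonneg.trans hy.1
        have hxy : edist x y ≤ ENNReal.ofReal r := by
          rw [edist_comm, edist_le_ofReal hr]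
          exact hy.1
        rw [mem_closedBall, ← edist_le_ofReal (by positivity), edist_comm,
          ENNReal.ofReal_mul zero_le_two, ENNReal.ofReal_ofNat]
        exact h.trans (by gcongr)
    _ = 2 ^ s * ∫⁻ y in closedBall z (2 * r), edist z y ^ (-s) ∂μ :=
        lintegral_const_mul _ (by fun_prop)
    _ ≤ 2 ^ s * b := by gcongr; exact hb z hzC

theorem continuous_lintegral_max_edist_rpow (hs : 0 ≤ s) (ν : Measure X) [IsFiniteMeasure ν]
    {r : ℝ} (hr : 0 < r) :
    Continuous fun x ↦ ∫⁻ y, max (edist x y) (ENNReal.ofReal r) ^ (-s) ∂ν := by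
  refine continuous_iff_continuousAt.2 fun x ↦ ?_
  refine tendsto_lintegral_filter_of_dominated_convergence (fun _ ↦ ENNReal.ofReal r ^ (-s))
    (Eventually.of_forall fun z ↦ by fun_prop)
    (Eventually.of_forall fun z ↦ ae_of_all _ fun y ↦ max_edist_rpow_neg_le hs r z y)
    (lintegral_ofReal_rpow_neg_lt_top ν hr).ne (ae_of_all _ fun y ↦ ?_)
  have : Continuous fun z ↦ max (edist z y) (ENNReal.ofReal r) ^ (-s) :=
    ENNReal.continuous_rpow_const.comp (by fun_prop)
  exact this.tendsto x

theorem lintegral_edist_rpow_le_add (ν : Measure X) (r : ℝ) (x : X) :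
    ∫⁻ y, edist x y ^ (-s) ∂ν ≤ ∫⁻ y, max (edist x y) (ENNReal.ofReal r) ^ (-s) ∂ν +
      ∫⁻ y in closedBall x r, edist x y ^ (-s) ∂ν := by
  have hball : MeasurableSet (closedBall x r) := measurableSet_closedBall
  rw [← lintegral_add_compl (fun y ↦ edist x y ^ (-s)) hball, add_comm]
  refine add_le_add ?_ le_rfl
  refine (setLIntegral_mono' hball.compl fun y hy ↦ ?_).trans
    (setLIntegral_le_lintegral _ _)
  rw [max_eq_left]
  rw [mem_compl_iff, mem_closedBall, not_le] at hy
  rw [edist_comm, edist_dist]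
  exact ENNReal.ofReal_le_ofReal hy.le

/-- A Riesz potential of a finite measure is finite and continuous as soon as the contribution of
balls is small, uniformly in the centre. -/
theorem lintegral_edist_rpow_ne_top_and_continuous (hs : 0 ≤ s) (ν : Measure X)
    [IsFiniteMeasure ν]
    (h : ∀ η : ℝ≥0, 0 < η → ∃ r > 0, ∀ x, ∫⁻ y in closedBall x r, edist x y ^ (-s) ∂ν ≤ η) :
    (∀ x, ∫⁻ y, edist x y ^ (-s) ∂ν ≠ ⊤) ∧ Continuous fun x ↦ ∫⁻ y, edist x y ^ (-s) ∂ν := by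
  choose! r hr hb using h
  let T (η : {η : ℝ≥0 // 0 < η}) (x : X) : ℝ≥0∞ :=
    ∫⁻ y, max (edist x y) (ENNReal.ofReal (r η)) ^ (-s) ∂ν
  have hle (η x) : T η x ≤ ∫⁻ y, edist x y ^ (-s) ∂ν := lintegral_max_edist_rpow_le hs _ _ _
  have hge (η x) : ∫⁻ y, edist x y ^ (-s) ∂ν ≤ T η x + (η : ℝ≥0) :=
    (lintegral_edist_rpow_le_add ν (r η) x).trans (by gcongr; exact hb _ η.2 x)
  have hT (η) : Continuous (T η) := continuous_lintegral_max_edist_rpow hs ν (hr _ η.2)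
  refine ⟨fun x ↦ ?_, continuous_iff_lower_upperSemicontinuous.2 ⟨?_, ?_⟩⟩
  · refine ((hge ⟨1, one_pos⟩ x).trans_lt ?_).ne
    exact ENNReal.add_lt_top.2
      ⟨lintegral_max_edist_rpow_lt_top hs ν (hr _ one_pos) x, ENNReal.coe_lt_top⟩
  · have heq : (fun x ↦ ∫⁻ y, edist x y ^ (-s) ∂ν) = fun x ↦ ⨆ η, T η x := by
      ext x
      refine le_antisymm (ENNReal.le_of_forall_pos_le_add fun η hη _ ↦ ?_)
        (iSup_le fun η ↦ hle η x)
      exact (hge ⟨η, hη⟩ x).trans (by gcongr; exact le_iSup (T · x) ⟨η, hη⟩)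
    rw [heq]
    exact lowerSemicontinuous_iSup fun η ↦ (hT η).lowerSemicontinuous
  · have heq : (fun x ↦ ∫⁻ y, edist x y ^ (-s) ∂ν) =
        fun x ↦ ⨅ η : {η : ℝ≥0 // 0 < η}, (T η x + (η : ℝ≥0)) := by
      ext x
      refine le_antisymm (le_iInf fun η ↦ hge η x)
        (ENNReal.le_of_forall_pos_le_add fun η hη _ ↦ ?_)
      exact (iInf_le _ (⟨η, hη⟩ : {η : ℝ≥0 // 0 < η})).trans (by gcongr; exact hle _ x)
    rw [heq]
    exact upperSemicontinuous_iInf fun η ↦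
      ((hT η).add continuous_const).upperSemicontinuous

theorem measurable_setLIntegral_closedBall_edist_rpow [SecondCountableTopology X]
    (μ : Measure X) [SFinite μ] (r : ℝ) :
    Measurable fun x ↦ ∫⁻ y in closedBall x r, edist x y ^ (-s) ∂μ := by
  have h : Measurable ({p : X × X | dist p.2 p.1 ≤ r}.indicator
      fun p ↦ edist p.1 p.2 ^ (-s)) :=
    Measurable.indicator (by fun_prop) (measurableSet_le (by fun_prop) measurable_const)
  convert! h.lintegral_prod_right' (ν := μ) using 2 with x
  rw [← lintegral_indicator measurableSet_closedBall]
  rfl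

/-- A finite measure on a compact set with everywhere finite Riesz potential there can be
restricted to a compact set of almost full measure so that the potential becomes continuous. -/
theorem exists_isCompact_continuous_lintegral_edist_rpow [SecondCountableTopology X]
    (hs : 0 < s) (μ : Measure X) [IsFiniteMeasure μ] {S : Set X} (hS : IsCompact S)
    (hfin : ∀ x ∈ S, ∫⁻ y, edist x y ^ (-s) ∂μ ≠ ⊤) {ε : ℝ≥0∞} (hε : 0 < ε) :
    ∃ C ⊆ S, IsCompact C ∧ μ (S \ C) < ε ∧
      (∀ x, ∫⁻ y in C, edist x y ^ (-s) ∂μ ≠ ⊤) ∧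
      Continuous fun x ↦ ∫⁻ y in C, edist x y ^ (-s) ∂μ := by
  let F (n : ℕ) (x : X) : ℝ≥0∞ :=
    ∫⁻ y in closedBall x (2 * (1 / ((n : ℝ) + 1))), edist x y ^ (-s) ∂μ
  have hF_top (n) (x) (hx : x ∈ S) : F n x ≠ ⊤ :=
    ((setLIntegral_le_lintegral _ _).trans_lt (hfin x hx).lt_top).ne
  have hF_lim (x) (hx : x ∈ S) : Tendsto (fun n ↦ (F n x).toReal) atTop (𝓝 0) := by
    have hr : Tendsto (fun n : ℕ ↦ 2 * (1 / ((n : ℝ) + 1))) atTop (𝓝 0) := by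
      simpa using (tendsto_one_div_add_atTop_nhds_zero_nat (𝕜 := ℝ)).const_mul 2
    exact (ENNReal.tendsto_toReal ENNReal.zero_ne_top).comp
      (tendsto_setLIntegral_closedBall_edist_rpow hs (hfin x hx) (fun n ↦ by positivity) hr)
  obtain ⟨δ, hδ, hδε⟩ : ∃ δ : ℝ≥0, 0 < δ ∧ (δ : ℝ≥0∞) < ε := ENNReal.lt_iff_exists_nnreal_btwn.1 hε
    |>.imp fun δ h ↦ ⟨by exact_mod_cast h.1, h.2⟩
  obtain ⟨t, htS, ht, hμt, hunif⟩ := tendstoUniformlyOn_of_ae_tendsto (μ := μ)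
    (f := fun n x ↦ (F n x).toReal) (g := fun _ ↦ 0) (s := S)
    (fun n ↦ (measurable_setLIntegral_closedBall_edist_rpow μ _).ennreal_toReal.stronglyMeasurable)
    stronglyMeasurable_const hS.measurableSet (measure_ne_top _ _)
    (ae_of_all _ hF_lim) (NNReal.coe_pos.2 hδ)
  rw [ENNReal.ofReal_coe_nnreal] at hμt
  obtain ⟨C, hCsub, hC, hμC⟩ : ∃ C ⊆ S \ t, IsCompact C ∧ μ ((S \ t) \ C) < ε - δ := by
    obtain ⟨K, hKsub, hK, hμK⟩ := (hS.measurableSet.diff ht).exists_isClosed_sdiff_lt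
      (measure_ne_top μ _) (tsub_pos_of_lt hδε).ne'
    exact ⟨K, hKsub, hS.of_isClosed_subset hK (hKsub.trans sdiff_subset), hμK⟩
  have hCS : C ⊆ S := hCsub.trans sdiff_subset
  refine ⟨C, hCS, hC, ?_, lintegral_edist_rpow_ne_top_and_continuous hs.le _ fun η hη ↦ ?_⟩
  · calc μ (S \ C) ≤ μ (t ∪ (S \ t) \ C) := measure_mono fun x hx ↦ by
          by_cases hxt : x ∈ t
          exacts [Or.inl hxt, Or.inr ⟨⟨hx.1, hxt⟩, hx.2⟩]
      _ ≤ μ t + μ ((S \ t) \ C) := measure_union_le _ _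
      _ < δ + (ε - δ) := ENNReal.add_lt_add_of_le_of_lt (measure_ne_top _ _) hμt hμC
      _ = ε := add_tsub_cancel_of_le hδε.le
  · have hpos : 0 < (η : ℝ) / 2 ^ s := by positivity
    obtain ⟨n, hn⟩ := (Metric.tendstoUniformlyOn_iff.1 hunif _ hpos).exists
    refine ⟨1 / ((n : ℝ) + 1), by positivity, fun x ↦ ?_⟩
    refine (setLIntegral_closedBall_edist_rpow_restrict_le hs hC
      (b := ENNReal.ofReal (η / 2 ^ s)) (fun z hz ↦ ?_) x).trans_eq ?_
    · have h := hn z (hCsub hz)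
      rw [dist_zero_left, Real.norm_of_nonneg ENNReal.toReal_nonneg] at h
      exact (ENNReal.le_ofReal_iff_toReal_le (hF_top n z (hCS hz)) hpos.le).2 h.le
    · rw [← ENNReal.ofReal_ofNat, ENNReal.ofReal_rpow_of_pos two_pos,
        ← ENNReal.ofReal_mul (by positivity), mul_div_cancel₀ _ (by positivity),
        ENNReal.ofReal_coe_nnreal]

end RieszPotential

/-- if a finite Borel measure `μ` on `ℝ^m` (`m ≥ 3`) is carried by
a compact set `S` and its potential is finite on `S`, then for every `ε > 0`
there is a compact `C ⊆ S` with `μ(S ∖ C) < ε` such that the potential of the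
restricted measure `μ|C` is finite and continuous on all of `ℝ^m`. -/
theorem exists_compact_restriction_with_continuous_potential
    (m : ℕ) (hm : 3 ≤ m)
    (μ : Measure (EuclideanSpace ℝ (Fin m))) [IsFiniteMeasure μ]
    (S : Set (EuclideanSpace ℝ (Fin m))) (hS : IsCompact S) (hμS : μ Sᶜ = 0)
    (hfin : ∀ x ∈ S, newtonPot m μ x ≠ ⊤) :
    ∀ ε : ENNReal, 0 < ε →
      ∃ C : Set (EuclideanSpace ℝ (Fin m)), C ⊆ S ∧ IsCompact C ∧
        μ (S \ C) < ε ∧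
        (∀ x, newtonPot m (μ.restrict C) x ≠ ⊤) ∧
        Continuous (newtonPot m (μ.restrict C)) := by
  intro ε hε
  have hs : 0 < (m : ℝ) - 2 := by
    have : (3 : ℝ) ≤ m := by exact_mod_cast hm
    linarith
  exact exists_isCompact_continuous_lintegral_edist_rpow hs μ hS hfin hε
end

section
/- Let m ≥ 3 be an integer, μ a finite Borel measure on ℝ^m, and S a compact subset of ℝ^m with μ(ℝ^m ∖ S) = 0, and suppose that the potential U_μ(x) = ∫ ‖x − y‖^{−(m−2)} dμ(y) is finite at every x ∈ S. Then there exists a nondecreasing sequence of compact sets C_n ⊆ S such that the potentials U_{μ|C_n} of the restricted measures μ|C_n are continuous on ℝ^m, form a nondecreasing sequence of functions, and converge pointwise on ℝ^m to U_μ. -/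
open MeasureTheory

open Filter Topology ENNReal

/-- A uniform limit from below of continuous finite functions is continuous. -/
lemma continuous_of_uniform_approx {Y : Type*} [TopologicalSpace Y] {U : Y → ℝ≥0∞}
    (h : ∀ ε : ℝ≥0∞, 0 < ε → ∃ V : Y → ℝ≥0∞, Continuous V ∧ (∀ x, V x ≠ ∞) ∧
      (∀ x, V x ≤ U x) ∧ ∀ x, U x ≤ V x + ε) : Continuous U := by
  rw [continuous_iff_continuousAt]
  intro x
  have hU : U x ≠ ∞ := by
    obtain ⟨V, -, hV, -, hUV⟩ := h 1 one_pos
    exact ne_top_of_le_ne_top (ENNReal.add_ne_top.2 ⟨hV x, one_ne_top⟩) (hUV x)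
  refine (ENNReal.tendsto_nhds hU).2 fun ε hε => ?_
  obtain ⟨V, hc, hV, hle, hUV⟩ := h (ε / 2) (ENNReal.half_pos hε.ne')
  filter_upwards [(ENNReal.tendsto_nhds (hV x)).1 (hc.tendsto x) (ε / 2)
    (ENNReal.half_pos hε.ne')] with z hz
  constructor
  · rw [tsub_le_iff_right]
    calc U x ≤ V x + ε / 2 := hUV x
      _ ≤ V z + ε / 2 + ε / 2 := by gcongr; exact tsub_le_iff_right.1 hz.1
      _ = V z + ε := by rw [add_assoc, ENNReal.add_halves]
      _ ≤ U z + ε := by gcongr; exact hle z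
  · calc U z ≤ V z + ε / 2 := hUV z
      _ ≤ V x + ε / 2 + ε / 2 := by gcongr; exact hz.2
      _ = V x + ε := by rw [add_assoc, ENNReal.add_halves]
      _ ≤ U x + ε := by gcongr; exact hle x

lemma edist_rpow_neg_le {X : Type*} [PseudoEMetricSpace X] {s : ℝ} (hs : 0 ≤ s) {x z y : X}
    (h : edist z y ≤ 2 * edist x y) :
    edist x y ^ (-s) ≤ 2 ^ s * edist z y ^ (-s) := by
  have h2 : (2 : ℝ≥0∞) ^ s ≠ 0 := by simp
  have h2t : (2 : ℝ≥0∞) ^ s ≠ ∞ := ENNReal.rpow_ne_top_of_nonneg hs ofNat_ne_top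
  have h1 : edist z y ^ s ≤ 2 ^ s * edist x y ^ s := by
    rw [← ENNReal.mul_rpow_of_nonneg _ _ hs]
    exact ENNReal.rpow_le_rpow h hs
  rw [ENNReal.rpow_neg, ENNReal.rpow_neg]
  calc (edist x y ^ s)⁻¹ = 2 ^ s * (2 ^ s * edist x y ^ s)⁻¹ := by
        rw [ENNReal.mul_inv (.inl h2) (.inl h2t), ← mul_assoc, ENNReal.mul_inv_cancel h2 h2t,
          one_mul]
    _ ≤ _ := by gcongr

section RieszKernel

variable {X : Type*} [MetricSpace X] [MeasurableSpace X]

/-- The integral of the part of the kernel `edist x y ^ (-s)` exceeding the level `c`. -/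
noncomputable def kernelExcess (s : ℝ) (μ : Measure X) (c : ℝ≥0∞) (x : X) : ℝ≥0∞ :=
  ∫⁻ y, (edist x y ^ (-s) - c) ∂μ

/-- The integral of the kernel `edist x y ^ (-s)` truncated at the level `c`. -/
noncomputable def truncatedPotential (s : ℝ) (μ : Measure X) (c : ℝ≥0∞) (x : X) : ℝ≥0∞ :=
  ∫⁻ y, min (edist x y ^ (-s)) c ∂μ

lemma measurable_kernelExcess [SecondCountableTopology X] [BorelSpace X] (s : ℝ) (μ : Measure X)
    [SFinite μ] (c : ℝ≥0∞) : Measurable (kernelExcess s μ c) := by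
  unfold kernelExcess
  refine Measurable.lintegral_prod_right' (f := fun p : X × X => edist p.1 p.2 ^ (-s) - c) ?_
  exact (measurable_edist.pow_const _).sub_const _

lemma kernelExcess_add_truncatedPotential [BorelSpace X] (s : ℝ) (μ : Measure X) (c : ℝ≥0∞)
    (x : X) :
    kernelExcess s μ c x + truncatedPotential s μ c x = ∫⁻ y, edist x y ^ (-s) ∂μ := by
  unfold kernelExcess truncatedPotential
  rw [← lintegral_add_left ((measurable_edist_right.pow_const _).sub_const _)]
  simp only [tsub_add_min]

lemma tendsto_kernelExcess [BorelSpace X] (s : ℝ) (μ : Measure X) (x : X)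
    (h : ∫⁻ y, edist x y ^ (-s) ∂μ ≠ ∞) :
    Tendsto (fun n : ℕ => kernelExcess s μ n x) atTop (𝓝 0) := by
  have hm : Measurable fun y => edist x y ^ (-s) := measurable_edist_right.pow_const _
  rw [← lintegral_zero (μ := μ)]
  refine tendsto_lintegral_of_dominated_convergence (fun y => edist x y ^ (-s))
    (fun n => hm.sub_const _) (fun n => ae_of_all _ fun y => tsub_le_self) h ?_
  filter_upwards [ae_lt_top hm h] with y hy
  obtain ⟨N, hN⟩ := ENNReal.exists_nat_gt hy.ne
  refine tendsto_const_nhds.congr' ?_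
  filter_upwards [eventually_ge_atTop N] with n hn
  exact (tsub_eq_zero_of_le (hN.le.trans (by exact_mod_cast hn))).symm

lemma truncatedPotential_ne_top (s : ℝ) (μ : Measure X) [IsFiniteMeasure μ] {c : ℝ≥0∞}
    (hc : c ≠ ∞) (x : X) : truncatedPotential s μ c x ≠ ∞ := by
  refine ne_top_of_le_ne_top ?_ (lintegral_mono (g := fun _ => c) fun y => min_le_right _ _)
  rw [lintegral_const]
  exact ENNReal.mul_ne_top hc (measure_ne_top _ _)

lemma continuous_truncatedPotential [BorelSpace X] (s : ℝ) (μ : Measure X)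
    [IsFiniteMeasure μ] {c : ℝ≥0∞} (hc : c ≠ ∞) : Continuous (truncatedPotential s μ c) := by
  rw [continuous_iff_continuousAt]
  intro x
  refine tendsto_lintegral_filter_of_dominated_convergence (fun _ => c)
    (.of_forall fun z => (measurable_edist_right.pow_const _).min measurable_const)
    (.of_forall fun z => ae_of_all _ fun y => min_le_right _ _) ?_
    (ae_of_all _ fun y => ?_)
  · rw [lintegral_const]
    exact ENNReal.mul_ne_top hc (measure_ne_top _ _)
  · have : Continuous fun z => min (edist z y ^ (-s)) c :=
      (ENNReal.continuous_rpow_const.comp (continuous_id.edist continuous_const)).min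
        continuous_const
    exact this.tendsto x

/-- A weak maximum principle: the kernel excess off a compact set is controlled by the kernel
excess on it. -/
lemma exists_kernelExcess_le [BorelSpace X] {s : ℝ} (hs : 0 ≤ s) (μ : Measure X) {C : Set X}
    (hC : IsCompact C) (hne : C.Nonempty) (c : ℝ≥0∞) (x : X) :
    ∃ z ∈ C, kernelExcess s (μ.restrict C) (2 ^ s * c) x ≤
      2 ^ s * kernelExcess s (μ.restrict C) c z := by
  have h2t : (2 : ℝ≥0∞) ^ s ≠ ∞ := ENNReal.rpow_ne_top_of_nonneg hs ofNat_ne_top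
  obtain ⟨z, hz, hxz⟩ := hC.exists_infEDist_eq_edist hne x
  refine ⟨z, hz, ?_⟩
  unfold kernelExcess
  rw [← lintegral_const_mul _ ((measurable_edist_right.pow_const _).sub_const _)]
  refine setLIntegral_mono' hC.measurableSet fun y hy => ?_
  rw [ENNReal.mul_sub fun _ _ => h2t]
  refine tsub_le_tsub_right (edist_rpow_neg_le hs ?_) _
  calc edist z y ≤ edist x z + edist x y := edist_triangle_left _ _ _
    _ ≤ edist x y + edist x y := by
      gcongr
      exact hxz ▸ Metric.infEDist_le_edist_of_mem hy
    _ = 2 * edist x y := (two_mul _).symm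

/-- The continuity principle: if the kernel excess tends to zero uniformly on a compact set,
then the potential of the restriction to that set is continuous everywhere. -/
lemma continuous_potential_restrict [BorelSpace X] {s : ℝ} (hs : 0 ≤ s) (μ : Measure X)
    [IsFiniteMeasure μ] {C : Set X} (hC : IsCompact C)
    (h : ∀ ε : ℝ≥0∞, 0 < ε → ∀ᶠ n : ℕ in atTop, ∀ x ∈ C, kernelExcess s μ n x ≤ ε) :
    Continuous fun x => ∫⁻ y in C, edist x y ^ (-s) ∂μ := by
  rcases C.eq_empty_or_nonempty with rfl | hne
  · simpa using continuous_const
  have h2 : (2 : ℝ≥0∞) ^ s ≠ 0 := by simp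
  have h2t : (2 : ℝ≥0∞) ^ s ≠ ∞ := ENNReal.rpow_ne_top_of_nonneg hs ofNat_ne_top
  refine continuous_of_uniform_approx fun ε hε => ?_
  obtain ⟨n, hn⟩ := (h (ε / 2 ^ s) (ENNReal.div_pos hε.ne' h2t)).exists
  have hct : (2 : ℝ≥0∞) ^ s * n ≠ ∞ := ENNReal.mul_ne_top h2t (natCast_ne_top n)
  refine ⟨truncatedPotential s (μ.restrict C) (2 ^ s * n), continuous_truncatedPotential s _ hct,
    truncatedPotential_ne_top s _ hct, fun x => lintegral_mono fun y => min_le_left _ _,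
    fun x => ?_⟩
  rw [← kernelExcess_add_truncatedPotential s _ (2 ^ s * n), add_comm]
  gcongr
  obtain ⟨z, hz, hle⟩ := exists_kernelExcess_le hs μ hC hne n x
  calc _ ≤ 2 ^ s * kernelExcess s (μ.restrict C) n z := hle
    _ ≤ 2 ^ s * kernelExcess s μ n z := by
      gcongr
      exact lintegral_mono' Measure.restrict_le_self le_rfl
    _ ≤ 2 ^ s * (ε / 2 ^ s) := by gcongr; exact hn z hz
    _ = ε := ENNReal.mul_div_cancel h2 h2t

/-- By Egorov, the kernel excess tends to zero uniformly on compact sets of almost full measure. -/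
lemma exists_isCompact_kernelExcess_le [SecondCountableTopology X] [BorelSpace X]
    [CompleteSpace X] (s : ℝ) (μ : Measure X) [IsFiniteMeasure μ] {S : Set X} (hS : MeasurableSet S)
    (hfin : ∀ x ∈ S, ∫⁻ y, edist x y ^ (-s) ∂μ ≠ ∞) {δ : ℝ} (hδ : 0 < δ) :
    ∃ D ⊆ S, IsCompact D ∧ μ (S \ D) ≤ ENNReal.ofReal δ ∧
      ∀ ε : ℝ≥0∞, 0 < ε → ∀ᶠ n : ℕ in atTop, ∀ x ∈ D, kernelExcess s μ n x ≤ ε := by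
  have hEfin : ∀ (n : ℕ), ∀ x ∈ S, kernelExcess s μ n x ≠ ∞ := fun n x hx =>
    ne_top_of_le_ne_top (hfin x hx) (lintegral_mono fun _ => tsub_le_self)
  obtain ⟨t, -, ht, hμt, hunif⟩ := tendstoUniformlyOn_of_ae_tendsto (μ := μ)
    (f := fun (n : ℕ) x => (kernelExcess s μ n x).toReal) (g := fun _ => 0)
    (fun n => (measurable_kernelExcess s μ n).ennreal_toReal.stronglyMeasurable)
    stronglyMeasurable_const hS (measure_ne_top μ S)
    (ae_of_all _ fun x hx => by
      simpa [Function.comp_def] using (ENNReal.tendsto_toReal zero_ne_top).comp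
        (tendsto_kernelExcess s μ x (hfin x hx)))
    (half_pos hδ)
  obtain ⟨D, hDS, hD, hμD⟩ := (hS.diff ht).exists_isCompact_sdiff_lt (measure_ne_top μ _)
    (ENNReal.ofReal_pos.2 (half_pos hδ)).ne'
  refine ⟨D, hDS.trans Set.sdiff_subset, hD, ?_, fun ε hε => ?_⟩
  · calc μ (S \ D) ≤ μ (t ∪ (S \ t) \ D) := measure_mono fun x hx => by
          by_cases hxt : x ∈ t
          · exact .inl hxt
          · exact .inr ⟨⟨hx.1, hxt⟩, hx.2⟩
      _ ≤ ENNReal.ofReal (δ / 2) + ENNReal.ofReal (δ / 2) :=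
        (measure_union_le _ _).trans (add_le_add hμt hμD.le)
      _ = ENNReal.ofReal δ := by
        rw [← ENNReal.ofReal_add (half_pos hδ).le (half_pos hδ).le, add_halves]
  · rcases eq_or_ne ε ∞ with rfl | hεt
    · simp
    filter_upwards [Metric.tendstoUniformlyOn_iff.1 hunif ε.toReal
      (ENNReal.toReal_pos hε.ne' hεt)] with n hn x hx
    have := hn x (hDS hx)
    rw [dist_zero_left, Real.norm_of_nonneg toReal_nonneg] at this
    exact ((ENNReal.toReal_lt_toReal (hEfin n x (hDS hx).1) hεt).1 this).le

theorem exists_monotone_isCompact_continuous_potential [SecondCountableTopology X]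
    [BorelSpace X] [CompleteSpace X] {s : ℝ} (hs : 0 ≤ s) (μ : Measure X)
    [IsFiniteMeasure μ] {S : Set X} (hS : MeasurableSet S) (hμS : μ Sᶜ = 0)
    (hfin : ∀ x ∈ S, ∫⁻ y, edist x y ^ (-s) ∂μ ≠ ∞) :
    ∃ C : ℕ → Set X, (∀ n, C n ⊆ S) ∧ (∀ n, IsCompact (C n)) ∧ Monotone C ∧
      (∀ n, Continuous fun x => ∫⁻ y in C n, edist x y ^ (-s) ∂μ) ∧
      ∀ x, Tendsto (fun n => ∫⁻ y in C n, edist x y ^ (-s) ∂μ) atTop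
        (𝓝 (∫⁻ y, edist x y ^ (-s) ∂μ)) := by
  choose D hDS hD hμD hunif using fun n : ℕ =>
    exists_isCompact_kernelExcess_le s μ hS hfin (Nat.one_div_pos_of_nat (α := ℝ) (n := n))
  have hC := isCompact_accumulate hD
  refine ⟨Set.accumulate D, fun n => Set.iUnion₂_subset fun k _ => hDS k, hC,
    Set.monotone_accumulate, fun n => ?_, fun x => ?_⟩
  · refine continuous_potential_restrict hs μ (hC n) fun ε hε => ?_
    filter_upwards [(Set.finite_Iic n).eventually_all.2 fun k _ => hunif k ε hε] with N hN x hx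
    obtain ⟨k, hk, hxk⟩ := Set.mem_accumulate.1 hx
    exact hN k hk x hxk
  · have hnull : μ (⋃ n, Set.accumulate D n)ᶜ = 0 := by
      rw [Set.iUnion_accumulate]
      have hz : μ (S \ ⋃ n, D n) = 0 := by
        have hlim := ENNReal.tendsto_ofReal (tendsto_one_div_add_atTop_nhds_zero_nat (𝕜 := ℝ))
        rw [ENNReal.ofReal_zero] at hlim
        exact le_antisymm (ge_of_tendsto' hlim fun n => (measure_mono
          (Set.sdiff_subset_sdiff_right (Set.subset_iUnion D n))).trans (hμD n)) zero_le
      refine measure_mono_null (fun x hx => ?_) (measure_union_null hμS hz)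
      by_cases hxS : x ∈ S
      · exact .inr ⟨hxS, hx⟩
      · exact .inl hxS
    have key := setLIntegral_iUnion_of_directed (μ := μ) (fun y => edist x y ^ (-s))
      (Set.monotone_accumulate (s := D)).directed_le
    rw [Measure.restrict_eq_self_of_ae_mem (s := ⋃ n, Set.accumulate D n)
      (mem_ae_iff.2 hnull)] at key
    rw [key]
    exact tendsto_atTop_iSup fun a b hab => lintegral_mono_set (Set.monotone_accumulate hab)

end RieszKernel

/-- if a finite Borel measure `μ` on `ℝ^m` (`m ≥ 3`) is carried by
a compact set `S` and its potential is finite on `S`, then there is a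
nondecreasing sequence of compact subsets `C n ⊆ S` such that the potentials of
the restricted measures `μ|C n` are continuous, nondecreasing in `n`, and
converge pointwise to the potential of `μ`. -/
theorem exists_increasing_compacts_with_continuous_potentials
    (m : ℕ) (hm : 3 ≤ m)
    (μ : Measure (EuclideanSpace ℝ (Fin m))) [IsFiniteMeasure μ]
    (S : Set (EuclideanSpace ℝ (Fin m))) (hS : IsCompact S) (hμS : μ Sᶜ = 0)
    (hfin : ∀ x ∈ S, newtonPot m μ x ≠ ⊤) :
    ∃ C : ℕ → Set (EuclideanSpace ℝ (Fin m)),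
      (∀ n, C n ⊆ S) ∧ (∀ n, IsCompact (C n)) ∧ Monotone C ∧
      (∀ n, Continuous (newtonPot m (μ.restrict (C n)))) ∧
      (∀ n x, newtonPot m (μ.restrict (C n)) x ≤
        newtonPot m (μ.restrict (C (n + 1))) x) ∧
      (∀ x, Filter.Tendsto (fun n => newtonPot m (μ.restrict (C n)) x)
        Filter.atTop (nhds (newtonPot m μ x))) := by
  have hm' : (0 : ℝ) ≤ (m : ℝ) - 2 := by
    have : (3 : ℝ) ≤ m := by exact_mod_cast hm
    linarith
  obtain ⟨C, hCS, hC, hmono, hcont, hlim⟩ :=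
    exists_monotone_isCompact_continuous_potential hm' μ hS.measurableSet hμS hfin
  exact ⟨C, hCS, hC, hmono, hcont, fun n x => lintegral_mono_set (hmono n.le_succ), hlim⟩
end

section
/- Let X be a locally compact, σ-compact, Hausdorff topological space that is not compact. For bounded continuous functions f, f_n : X → ℝ, say that f_n B-converges to f if sup_n ‖f_n‖_∞ < ∞ and f_n → f uniformly on every compact subset of X. For A a set of bounded continuous functions on X, let [A] denote the set of B-limits of sequences of elements of A. Then the sequential closure operator associated with B-convergence is not idempotent: there exists a set A of bounded continuous functions on X such that the zero function does not belong to [A] but belongs to [[A]]. In particular no Fréchet–Urysohn topology on the bounded continuous functions induces B-convergence. -/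
/-- `B`-convergence of a sequence of bounded continuous functions: uniform
boundedness in sup norm together with uniform convergence on every compact
set. -/
def BConv {X : Type*} [TopologicalSpace X]
    (f : ℕ → BoundedContinuousFunction X ℝ) (g : BoundedContinuousFunction X ℝ) : Prop :=
  (∃ M : ℝ, ∀ n, ‖f n‖ ≤ M) ∧
    ∀ K : Set X, IsCompact K →
      TendstoUniformlyOn (fun n x => f n x) (fun x => g x) Filter.atTop K

/-- Sequential closure with respect to `B`-convergence. -/
def BSeqClosure {X : Type*} [TopologicalSpace X]
    (A : Set (BoundedContinuousFunction X ℝ)) : Set (BoundedContinuousFunction X ℝ) :=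
  {g | ∃ f : ℕ → BoundedContinuousFunction X ℝ, (∀ n, f n ∈ A) ∧ BConv f g}

open Filter Topology BoundedContinuousFunction in
/-- Bump functions escaping to infinity along an exhaustion by compact sets. -/
theorem exists_seq_bump_eventually_zero_on_compacts
    {X : Type*} [TopologicalSpace X] [LocallyCompactSpace X] [SigmaCompactSpace X]
    [T2Space X] (hX : ¬ CompactSpace X) :
    ∃ φ : ℕ → BoundedContinuousFunction X ℝ,
      (∀ m x, 0 ≤ φ m x) ∧ (∀ m x, φ m x ≤ 1) ∧ (∀ m, ∃ x, φ m x = 1) ∧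
      ∀ K : Set X, IsCompact K → ∀ᶠ m in atTop, ∀ x ∈ K, φ m x = 0 := by
  let E : CompactExhaustion X := CompactExhaustion.choice X
  have bump : ∀ m, ∃ φ : BoundedContinuousFunction X ℝ,
      (∀ x, 0 ≤ φ x) ∧ (∀ x, φ x ≤ 1) ∧ (∃ x, φ x = 1) ∧ ∀ x ∈ E m, φ x = 0 := by
    intro m
    obtain ⟨y, hy⟩ : ∃ y, y ∉ E m := by
      by_contra! h
      exact hX ⟨by simpa [Set.eq_univ_of_forall h] using E.isCompact m⟩
    obtain ⟨f, hf0, hf1, hf⟩ := exists_continuous_zero_one_of_isCompact (E.isCompact m)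
      (isClosed_singleton (x := y)) (Set.disjoint_singleton_right.2 hy)
    refine ⟨ofNormedAddCommGroup f f.continuous 1 fun x => ?_,
      fun x => (hf x).1, fun x => (hf x).2, ⟨y, hf1 rfl⟩, fun x hx => hf0 hx⟩
    rw [Real.norm_eq_abs, abs_of_nonneg (hf x).1]
    exact (hf x).2
  choose φ h0 h1 hone hzero using bump
  refine ⟨φ, h0, h1, hone, fun K hK => ?_⟩
  obtain ⟨n, hn⟩ := E.exists_superset_of_isCompact hK
  filter_upwards [eventually_ge_atTop n] with m hm x hx
  exact hzero m x (E.subset hm (hn hx))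

open Filter Topology in
/-- On a locally compact, σ-compact, Hausdorff, noncompact space,
the sequential closure operator for `B`-convergence is not idempotent: there
exists a set `A` of bounded continuous functions with `0 ∉ [A]` but
`0 ∈ [[A]]`. -/
theorem bconv_seq_closure_not_idempotent
    {X : Type*} [TopologicalSpace X] [LocallyCompactSpace X] [SigmaCompactSpace X]
    [T2Space X] (hX : ¬ CompactSpace X) :
    ∃ A : Set (BoundedContinuousFunction X ℝ),
      (0 : BoundedContinuousFunction X ℝ) ∉ BSeqClosure A ∧
      (0 : BoundedContinuousFunction X ℝ) ∈ BSeqClosure (BSeqClosure A) := by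
  obtain ⟨φ, h0, h1, hone, hzero⟩ := exists_seq_bump_eventually_zero_on_compacts hX
  let c : ℕ → BoundedContinuousFunction X ℝ :=
    fun n => BoundedContinuousFunction.const X (1 / ((n : ℝ) + 1))
  let f : ℕ → ℕ → BoundedContinuousFunction X ℝ := fun n m => c n + ((n : ℝ) + 1) • φ m
  have hf : ∀ n m x, f n m x = 1 / ((n : ℝ) + 1) + ((n : ℝ) + 1) * φ m x := fun _ _ _ => rfl
  have hpos : ∀ n : ℕ, 0 < 1 / ((n : ℝ) + 1) := fun n => Nat.one_div_pos_of_nat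
  have hle : ∀ n : ℕ, 1 / ((n : ℝ) + 1) ≤ 1 := fun n => by
    rw [div_le_one (by positivity)]
    linarith [n.cast_nonneg (α := ℝ)]
  refine ⟨{g | ∃ n m, g = f n m}, ?_, c, fun n => ⟨f n, fun m => ⟨n, m, rfl⟩, ?_, ?_⟩, ?_, ?_⟩
  · rintro ⟨g, hg, ⟨M, hM⟩, hlim⟩
    choose n m hnm using hg
    have hn : ∀ k, (n k : ℝ) + 1 ≤ M := fun k => by
      obtain ⟨x, hx⟩ := hone (m k)
      have hgx := (le_abs_self _).trans (((g k).norm_coe_le_norm x).trans (hM k))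
      rw [hnm k, hf, hx] at hgx
      linarith [hpos (n k)]
    have hMpos : 0 < M := lt_of_lt_of_le (by positivity) (hn 0)
    obtain ⟨x, -⟩ := hone 0
    have hx : Tendsto (fun k => g k x) atTop (𝓝 0) :=
      (hlim {x} isCompact_singleton).tendsto_at rfl
    have hge : ∀ k, 1 / M ≤ g k x := fun k => by
      rw [hnm k, hf]
      have := one_div_le_one_div_of_le (by positivity) (hn k)
      have := mul_nonneg (by positivity : (0 : ℝ) ≤ (n k : ℝ) + 1) (h0 (m k) x)
      linarith
    exact absurd (ge_of_tendsto' hx hge) (not_le.2 (by positivity))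
  · refine ⟨1 + ((n : ℝ) + 1), fun m => ?_⟩
    refine (BoundedContinuousFunction.norm_le (by positivity)).2 fun x => ?_
    have hnn := mul_nonneg (by positivity : (0 : ℝ) ≤ (n : ℝ) + 1) (h0 m x)
    have := mul_le_of_le_one_right (by positivity : (0 : ℝ) ≤ (n : ℝ) + 1) (h1 m x)
    rw [hf, Real.norm_eq_abs, abs_of_nonneg (by linarith [hpos n])]
    linarith [hle n]
  · intro K hK
    rw [Metric.tendstoUniformlyOn_iff]
    intro ε hε
    filter_upwards [hzero K hK] with m hm x hx
    simpa [hf, hm x hx, c] using hε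
  · refine ⟨1, fun n => (BoundedContinuousFunction.norm_le zero_le_one).2 fun x => ?_⟩
    change ‖1 / ((n : ℝ) + 1)‖ ≤ 1
    rw [Real.norm_eq_abs, abs_of_pos (hpos n)]
    exact hle n
  · intro K _
    rw [Metric.tendstoUniformlyOn_iff]
    intro ε hε
    filter_upwards [tendsto_one_div_add_atTop_nhds_zero_nat.eventually_lt_const hε]
      with n hn x _
    change dist (0 : ℝ) (1 / ((n : ℝ) + 1)) < ε
    rwa [dist_zero_left, Real.norm_eq_abs, abs_of_pos (hpos n)]
end
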